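/- arXiv:2505.07221 — 2 statements merged into one kernel-verified Lean document; each statement's English description precedes it below -/
import Mathlib

section
/- Let k ≥ 2 be an integer. For every admissible index κ of weight k there exists a unique family of integers (c_{κ;l})_{l∈I^{≥2}_k} such that for every positive integer N: ζ^◇_N(κ) = Σ_{l∈I^{≥2}_k} c_{κ;l}·ζ_N(l). -/
open scoped Classical

/-- The modified multiple harmonic sum `ζ◇_N(k)` for an index given as a list. -/
noncomputable def zdiaL (N : ℕ) (k : List ℕ) : ℚ :=
  ∑ A : Finset (Fin k.length),
    if ∀ i ∈ A, k.get i = 1 then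
      ∑ n ∈ Finset.univ.filter (fun n : Fin k.length → Fin N =>
        (∀ i, 0 < (n i : ℕ)) ∧
        ∀ (i : Fin k.length) (h : (i : ℕ) + 1 < k.length),
          if i ∈ A then n i ≤ n ⟨(i : ℕ) + 1, h⟩ else n i < n ⟨(i : ℕ) + 1, h⟩),
        ∏ i : Fin k.length,
          if i ∈ A then (1 : ℚ) / ((N : ℚ) - ((n i : ℕ) : ℚ))
          else (1 : ℚ) / (((n i : ℕ) : ℚ) ^ k.get i)
    else 0

/-- The multiple harmonic sum `ζ_N(k) = ∑_{0<n₁<⋯<n_r<N} 1/(n₁^{k₁}⋯n_r^{k_r})`. -/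
noncomputable def mhsL (N : ℕ) (k : List ℕ) : ℚ :=
  ∑ n ∈ Finset.univ.filter (fun n : Fin k.length → Fin N =>
      (∀ i, 0 < (n i : ℕ)) ∧ StrictMono n),
    ∏ i : Fin k.length, (1 : ℚ) / (((n i : ℕ) : ℚ) ^ k.get i)
/-! ### Part 1: the recursive form of the modified sums -/

def zCond {N r : ℕ} (b : Fin r → Bool) (n : Fin r → Fin N) (m : ℕ) : Prop :=
  (∀ i, m ≤ (n i : ℕ)) ∧ ∀ (i : Fin r) (h : (i : ℕ) + 1 < r),
    if b i = true then n i ≤ n ⟨(i : ℕ) + 1, h⟩ else n i < n ⟨(i : ℕ) + 1, h⟩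

theorem zCond_cons {N r : ℕ} (b0 : Bool) (b : Fin r → Bool) (n0 : Fin N) (n : Fin r → Fin N)
    (m : ℕ) : zCond (Fin.cons b0 b : Fin (r+1) → Bool) (Fin.cons n0 n : Fin (r+1) → Fin N) m ↔
      m ≤ (n0 : ℕ) ∧ zCond b n (if b0 = true then (n0 : ℕ) else n0 + 1) := by
  unfold zCond
  constructor
  · rintro ⟨h1, h2⟩
    have h3 : ∀ (i : Fin r) (h : (i : ℕ) + 1 < r),
        if b i = true then n i ≤ n ⟨(i : ℕ) + 1, h⟩ else n i < n ⟨(i : ℕ) + 1, h⟩ := by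
      intro i h
      have := h2 i.succ (by simpa using h)
      have e : (⟨((i.succ : Fin (r+1)) : ℕ) + 1, by simpa using h⟩ : Fin (r+1)) =
          Fin.succ ⟨i + 1, h⟩ := by
        ext; simp
      rw [e] at this
      simpa only [Fin.cons_succ] using this
    refine ⟨by simpa using h1 0, ?_, h3⟩
    have h4 : ∀ (j : ℕ) (hj : j < r), (if b0 = true then (n0 : ℕ) else n0 + 1) ≤ (n ⟨j, hj⟩ : ℕ) := by
      intro j
      induction j with
      | zero =>
        intro hj
        have := h2 0 (by simpa using hj)
        have e : (⟨((0 : Fin (r+1)) : ℕ) + 1, by simpa using hj⟩ : Fin (r+1)) = Fin.succ ⟨0, hj⟩ := by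
          ext; simp
        rw [e] at this
        simp only [Fin.cons_zero, Fin.cons_succ] at this
        split_ifs with hb
        · rw [if_pos hb] at this; exact this
        · rw [if_neg hb] at this; exact this
      | succ j ih =>
        intro hj
        have h5 := ih (by omega)
        have h6 := h3 ⟨j, by omega⟩ hj
        have h7 : (n ⟨j, by omega⟩ : ℕ) ≤ (n ⟨j+1, hj⟩ : ℕ) := by
          split_ifs at h6
          · exact h6
          · exact le_of_lt h6
        omega
    intro i
    exact h4 i i.2
  · rintro ⟨h1, h2, h3⟩
    refine ⟨?_, ?_⟩
    · intro i
      refine Fin.cases ?_ (fun i => ?_) i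
      · simpa using h1
      · have := h2 i
        simp only [Fin.cons_succ]
        split_ifs at this <;> omega
    · intro i
      refine Fin.cases ?_ (fun i => ?_) i
      · intro h
        have e : (⟨((0 : Fin (r+1)) : ℕ) + 1, h⟩ : Fin (r+1)) = Fin.succ ⟨0, by simpa using h⟩ := by
          ext; simp
        rw [e]
        simp only [Fin.cons_zero, Fin.cons_succ]
        have := h2 ⟨0, by simpa using h⟩
        split_ifs with hb
        · rw [if_pos hb] at this; exact this
        · rw [if_neg hb] at this; exact this
      · intro h
        have := h3 i (by simpa using h)
        have e : (⟨((i.succ : Fin (r+1)) : ℕ) + 1, h⟩ : Fin (r+1)) =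
            Fin.succ ⟨i + 1, by simpa using h⟩ := by
          ext; simp
        rw [e]
        simpa only [Fin.cons_succ] using this

noncomputable def zS (N r : ℕ) (k : Fin r → ℕ) (m : ℕ) : ℚ :=
  ∑ b : Fin r → Bool, ∑ n : Fin r → Fin N,
    if (∀ i, b i = true → k i = 1) ∧ zCond b n m then
      ∏ i, (if b i = true then (1 : ℚ) / ((N : ℚ) - ((n i : ℕ) : ℚ))
          else (1 : ℚ) / (((n i : ℕ) : ℚ) ^ k i)) else 0

theorem zS_zero (N : ℕ) (k : Fin 0 → ℕ) (m : ℕ) : zS N 0 k m = 1 := by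
  simp [zS, zCond]

theorem sum_fin_cons {α M : Type*} [Fintype α] [AddCommMonoid M] (r : ℕ)
    (f : (Fin (r+1) → α) → M) :
    ∑ x, f x = ∑ a : α, ∑ x : Fin r → α, f (Fin.cons a x) := by
  rw [← Fintype.sum_prod_type' (f := fun a x => f (Fin.cons a x))]
  exact (Fintype.sum_equiv (Fin.consEquiv (fun _ => α)) _ _ (fun _ => rfl)).symm

theorem sum_Ico_fin (N m : ℕ) (f : ℕ → ℚ) :
    ∑ n ∈ Finset.Ico m N, f n = ∑ n : Fin N, if m ≤ (n : ℕ) then f n else 0 := by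
  rw [Fin.sum_univ_eq_sum_range (fun n => if m ≤ n then f n else 0) N, ← Finset.sum_filter]
  congr 1
  ext x
  simp [and_comm]

theorem zS_succ (N r : ℕ) (k : Fin (r+1) → ℕ) (m : ℕ) :
    zS N (r+1) k m = ∑ n ∈ Finset.Ico m N,
      ((1 / (n:ℚ)^(k 0)) * zS N r (fun i => k i.succ) (n+1) +
        if k 0 = 1 then (1 / ((N:ℚ) - n)) * zS N r (fun i => k i.succ) n else 0) := by
  rw [sum_Ico_fin]
  unfold zS
  rw [sum_fin_cons]
  simp only [Fintype.sum_bool]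
  simp_rw [sum_fin_cons (α := Fin N)]
  rw [Finset.sum_comm (s := (Finset.univ : Finset (Fin r → Bool))),
    Finset.sum_comm (s := (Finset.univ : Finset (Fin r → Bool))), ← Finset.sum_add_distrib]
  refine Finset.sum_congr rfl fun n0 _ => ?_
  simp only [zCond_cons, Fin.forall_fin_succ, Fin.cons_zero, Fin.cons_succ, Fin.prod_univ_succ,
    if_true, Bool.false_eq_true, if_false, forall_true_left, false_imp_iff, true_and]
  by_cases hm : m ≤ (n0 : ℕ)
  · by_cases hk : k 0 = 1
    · simp only [hm, hk, true_and, if_true, Finset.mul_sum, mul_ite, mul_zero]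
      rw [add_comm]
    · simp [hm, hk, Finset.mul_sum, mul_ite]
  · simp [hm]

noncomputable def Qd (N : ℕ) : List ℕ → ℕ → ℚ
  | [], _ => 1
  | k :: l, m => ∑ n ∈ Finset.Ico m N,
      ((1 / (n:ℚ)^k) * Qd N l (n+1) + if k = 1 then (1 / ((N:ℚ) - n)) * Qd N l n else 0)

theorem zS_eq_Qd (N : ℕ) (l : List ℕ) : ∀ m, zS N l.length l.get m = Qd N l m := by
  induction l with
  | nil => intro m; simpa [Qd] using zS_zero N _ m
  | cons k l ih =>
    intro m
    have := zS_succ N l.length (k :: l).get m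
    refine this.trans ?_
    simp only [Qd]
    refine Finset.sum_congr rfl fun n _ => ?_
    have e : (fun i : Fin l.length => (k :: l).get i.succ) = l.get := by ext i; simp
    rw [e, ih, ih]
    simp

theorem zdiaL_eq_zS (N : ℕ) (l : List ℕ) : zdiaL N l = zS N l.length l.get 1 := by
  unfold zdiaL zS
  refine Fintype.sum_equiv
    { toFun := fun A i => decide (i ∈ A)
      invFun := fun b => Finset.univ.filter (fun i => b i = true)
      left_inv := fun A => by ext; simp
      right_inv := fun b => by ext; simp } _ _ fun A => ?_
  simp only [Equiv.coe_fn_mk, decide_eq_true_eq, zCond]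
  by_cases h : ∀ i ∈ A, l.get i = 1
  · rw [if_pos h, Finset.sum_filter]
    refine Finset.sum_congr rfl fun n _ => ?_
    refine if_congr ?_ rfl rfl
    constructor
    · rintro ⟨h1, h2⟩; exact ⟨h, fun i => h1 i, by simpa using h2⟩
    · rintro ⟨_, h1, h2⟩; exact ⟨fun i => h1 i, by simpa using h2⟩
  · rw [if_neg h]
    symm
    refine Finset.sum_eq_zero fun n _ => if_neg fun h' => h h'.1

theorem zdiaL_eq_Qd (N : ℕ) (l : List ℕ) : zdiaL N l = Qd N l 1 := by
  rw [zdiaL_eq_zS, zS_eq_Qd]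

theorem mhsL_eq_zdiaL (N : ℕ) (l : List ℕ) (hl : ∀ x ∈ l, 2 ≤ x) : mhsL N l = zdiaL N l := by
  unfold mhsL zdiaL
  symm
  rw [Finset.sum_eq_single (∅ : Finset (Fin l.length))]
  symm
  · simp only [Finset.notMem_empty, IsEmpty.forall_iff, implies_true, if_true, if_false]
    refine Finset.sum_congr ?_ fun _ _ => rfl
    ext n
    simp only [Finset.mem_filter, Finset.mem_univ, true_and]
    refine and_congr_right fun _ => ?_
    constructor
    · intro h i hi
      exact h (by rw [Fin.lt_def]; simp)
    · intro h i j hij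
      have : ∀ (d : ℕ) (hd : (i : ℕ) + d + 1 < l.length), n i < n ⟨i + d + 1, hd⟩ := by
        intro d
        induction d with
        | zero => intro hd; exact h i hd
        | succ d ih =>
          intro hd
          exact (ih (by omega)).trans (h ⟨i + d + 1, by omega⟩ hd)
      have hij' : (i:ℕ) < j := hij
      have hl' : (i:ℕ) + (j - i - 1) + 1 < l.length := by have := j.2; omega
      have h2 := this (j - i - 1) hl'
      have e : (⟨(i:ℕ) + (j - i - 1) + 1, hl'⟩ : Fin l.length) = j := by
        apply Fin.ext
        simp only
        omega
      rw [e] at h2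
      exact h2
  · intro A _ hA
    rw [if_neg]
    intro h
    obtain ⟨i, hi⟩ := Finset.nonempty_iff_ne_empty.mpr hA
    have h1 := h i hi
    have h2 := hl (l.get i) (List.get_mem l i)
    omega
  · simp

/-! ### Part 2: compositions as lists, and the generating series -/

noncomputable def comps (j : ℕ) : Finset (List ℕ) :=
  (Finset.univ : Finset (Composition j)).image Composition.blocks

theorem mem_comps {j : ℕ} {l : List ℕ} : l ∈ comps j ↔ l.sum = j ∧ ∀ x ∈ l, 0 < x := by
  unfold comps
  simp only [Finset.mem_image, Finset.mem_univ, true_and]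
  constructor
  · rintro ⟨c, rfl⟩
    exact ⟨c.blocks_sum, fun x hx => c.blocks_pos hx⟩
  · rintro ⟨h1, h2⟩
    exact ⟨⟨l, fun {x} hx => h2 x hx, h1⟩, rfl⟩

theorem comps_zero : comps 0 = {[]} := by
  ext l
  rw [mem_comps, Finset.mem_singleton]
  constructor
  · rintro ⟨h1, h2⟩
    cases l with
    | nil => rfl
    | cons a l =>
      have := h2 a (by simp)
      simp at h1
      omega
  · rintro rfl; simp

theorem sum_comps_succ {M : Type*} [AddCommMonoid M] (j : ℕ) (f : List ℕ → M) :
    ∑ l ∈ comps (j+1), f l =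
      ∑ i ∈ Finset.range (j+1), ∑ l ∈ comps (j-i), f ((i+1) :: l) := by
  rw [Finset.sum_sigma']
  symm
  refine Finset.sum_bij (fun x _ => (x.1+1) :: x.2) ?_ ?_ ?_ ?_
  · rintro ⟨i, l⟩ h
    simp only [Finset.mem_sigma, Finset.mem_range, mem_comps] at h ⊢
    obtain ⟨h1, h2, h3⟩ := h
    refine ⟨by simp only [List.sum_cons]; omega, ?_⟩
    intro x hx
    rcases List.mem_cons.mp hx with rfl | hx
    · omega
    · exact h3 x hx
  · rintro ⟨i, l⟩ h ⟨i', l'⟩ h' he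
    simp at he
    obtain ⟨rfl, rfl⟩ := he
    rfl
  · intro l hl
    rw [mem_comps] at hl
    cases l with
    | nil => simp at hl
    | cons a l =>
      have ha := hl.2 a (by simp)
      have hs := hl.1
      simp only [List.sum_cons] at hs
      refine ⟨⟨a-1, l⟩, ?_, ?_⟩
      · simp only [Finset.mem_sigma, Finset.mem_range, mem_comps]
        exact ⟨by omega, by omega, fun x hx => hl.2 x (by simp [hx])⟩
      · simp; omega
  · intros; rfl

theorem sum_triangle {M : Type*} [AddCommMonoid M] (K : ℕ) (g : ℕ → ℕ → M)
    (hg : ∀ i j, K ≤ i + j → g i j = 0) :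
    ∑ j ∈ Finset.range K, ∑ i ∈ Finset.range (j+1), g i (j-i) =
      ∑ i ∈ Finset.range (K+1), ∑ j ∈ Finset.range (K+1), g i j := by
  rw [Finset.sum_sigma', ← Finset.sum_product']
  refine Finset.sum_of_injOn (fun x => (x.2, x.1 - x.2)) ?_ ?_ ?_ ?_
  · rintro ⟨j, i⟩ h ⟨j', i'⟩ h' he
    simp at h h' he
    obtain ⟨rfl, he⟩ := he
    have : j = j' := by omega
    subst this; rfl
  · rintro ⟨j, i⟩ h
    simp at h ⊢
    omega
  · rintro ⟨i, j⟩ h h'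
    apply hg
    by_contra hlt
    apply h'
    refine ⟨⟨i+j, i⟩, ?_, ?_⟩
    · simp; omega
    · simp
  · intros; rfl

theorem Qd_step (N : ℕ) (k : ℕ) (l : List ℕ) (m : ℕ) (hm : m < N) :
    Qd N (k :: l) m = Qd N (k :: l) (m+1) + ((1 / (m:ℚ)^k) * Qd N l (m+1) +
      if k = 1 then (1 / ((N:ℚ) - m)) * Qd N l m else 0) := by
  conv_lhs => rw [Qd]
  rw [Finset.sum_eq_sum_Ico_succ_bot hm, add_comm]
  rfl

theorem Qd_top (N : ℕ) (k : ℕ) (l : List ℕ) : Qd N (k :: l) N = 0 := by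
  simp [Qd]

section alg
variable {R : Type*} [Ring R] [Algebra ℚ R]

def zl (e0 e1 : R) : List ℕ → R
  | [] => 1
  | k :: l => e1 * e0^(k-1) * zl e0 e1 l

noncomputable def Psi (N K : ℕ) (e0 e1 : R) (m : ℕ) : R :=
  ∑ j ∈ Finset.range (K+1), ∑ l ∈ comps j, Qd N l m • zl e0 e1 l

theorem Psi_eq (N K : ℕ) (e0 e1 : R) (m : ℕ) :
    Psi N K e0 e1 m = 1 + ∑ j ∈ Finset.range K, ∑ i ∈ Finset.range (j+1), ∑ l ∈ comps (j-i),
      Qd N ((i+1)::l) m • (e1 * e0^i * zl e0 e1 l) := by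
  unfold Psi
  rw [Finset.sum_range_succ', comps_zero]
  simp only [sum_comps_succ]
  rw [add_comm]
  simp [Qd, zl]

theorem Psi_top (N K : ℕ) (e0 e1 : R) : Psi N K e0 e1 N = 1 := by
  rw [Psi_eq]
  simp [Qd_top]

theorem Psi_rel (N K : ℕ) (e0 e1 : R)
    (hz : ∀ l : List ℕ, (∀ x ∈ l, 0 < x) → K < l.sum → zl e0 e1 l = 0) (m : ℕ) (hm : m < N) :
    Psi N K e0 e1 m - (1 / ((N:ℚ) - m)) • (e1 * Psi N K e0 e1 m) =
      (1 + e1 * ∑ i ∈ Finset.range (K+1), (1 / (m:ℚ)^(i+1)) • e0^i) * Psi N K e0 e1 (m+1) := by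
  have key : Psi N K e0 e1 m = Psi N K e0 e1 (m+1)
      + (∑ j ∈ Finset.range K, ∑ i ∈ Finset.range (j+1), ∑ l ∈ comps (j-i),
          ((1 / (m:ℚ)^(i+1)) * Qd N l (m+1)) • (e1 * e0^i * zl e0 e1 l))
      + ∑ j ∈ Finset.range K, ∑ l ∈ comps j,
          ((1 / ((N:ℚ) - m)) * Qd N l m) • (e1 * zl e0 e1 l) := by
    rw [Psi_eq, Psi_eq, add_assoc, add_assoc, ← Finset.sum_add_distrib, ← Finset.sum_add_distrib]
    congr 1
    refine Finset.sum_congr rfl fun j _ => ?_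
    simp only [Qd_step N _ _ m hm, add_smul, Finset.sum_add_distrib]
    congr 2
    rw [Finset.sum_range_succ']
    simp
  have h2 : ∑ j ∈ Finset.range K, ∑ l ∈ comps j,
          ((1 / ((N:ℚ) - m)) * Qd N l m) • (e1 * zl e0 e1 l) =
          (1 / ((N:ℚ) - m)) • (e1 * Psi N K e0 e1 m) := by
    unfold Psi
    rw [Finset.sum_range_succ, mul_add, Finset.mul_sum, Finset.mul_sum, smul_add]
    have : ∑ l ∈ comps K, e1 * (Qd N l m • zl e0 e1 l) = 0 := by
      refine Finset.sum_eq_zero fun l hl => ?_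
      rw [mem_comps] at hl
      have h0 := hz (1 :: l) (by
        intro x hx
        rcases List.mem_cons.mp hx with rfl | hx
        · omega
        · exact hl.2 x hx) (by simp only [List.sum_cons]; omega)
      simp [zl] at h0
      rw [mul_smul_comm, h0, smul_zero]
    rw [this, smul_zero, add_zero, Finset.smul_sum]
    refine Finset.sum_congr rfl fun j _ => ?_
    rw [Finset.mul_sum, Finset.smul_sum]
    refine Finset.sum_congr rfl fun l _ => ?_
    rw [mul_smul_comm, smul_smul]
  have h3 : (∑ j ∈ Finset.range K, ∑ i ∈ Finset.range (j+1), ∑ l ∈ comps (j-i),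
          ((1 / (m:ℚ)^(i+1)) * Qd N l (m+1)) • (e1 * e0^i * zl e0 e1 l)) =
        (e1 * ∑ i ∈ Finset.range (K+1), (1 / (m:ℚ)^(i+1)) • e0^i) * Psi N K e0 e1 (m+1) := by
    rw [sum_triangle K (fun i j => ∑ l ∈ comps j,
          ((1 / (m:ℚ)^(i+1)) * Qd N l (m+1)) • (e1 * e0^i * zl e0 e1 l))]
    · rw [Finset.mul_sum, Finset.sum_mul]
      refine Finset.sum_congr rfl fun i _ => ?_
      unfold Psi
      rw [Finset.mul_sum]
      refine Finset.sum_congr rfl fun j _ => ?_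
      rw [Finset.mul_sum]
      refine Finset.sum_congr rfl fun l _ => ?_
      rw [mul_smul_comm, mul_smul_comm, smul_mul_assoc, smul_smul, mul_comm]
    · intro i j hij
      refine Finset.sum_eq_zero fun l hl => ?_
      rw [mem_comps] at hl
      have h0 := hz ((i+1) :: l) (by
        intro x hx
        rcases List.mem_cons.mp hx with rfl | hx
        · omega
        · exact hl.2 x hx) (by simp only [List.sum_cons]; omega)
      simp [zl] at h0
      rw [h0, smul_zero]
  rw [h2, h3] at key
  rw [add_mul, one_mul]
  nth_rewrite 1 [key]
  abel

theorem key_alg {R : Type*} [Ring R] (e1 y yi a ai b bi c : R) (hy : y * yi = 1) (hy' : yi * y = 1)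
    (ha : a * ai = 1) (ha' : ai * a = 1) (hb : b * bi = 1) (hb' : bi * b = 1)
    (hab : a * y + y * b = 1) (hbe : b * e1 = e1 * b) (hc : c * y = 1 + y * e1)
    (hac : a * c = c * a) :
    (1 + e1 * y) * bi * (1 + e1 * (yi * yi * ai * y * y)) =
      (1 + e1 * ai) * bi * (1 + e1 * y) := by
  have hbe' : bi * e1 = e1 * bi := by
    calc bi * e1 = bi * e1 * (b * bi) := by rw [hb, mul_one]
      _ = bi * (e1 * b) * bi := by noncomm_ring
      _ = (bi * b) * e1 * bi := by rw [← hbe]; noncomm_ring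
      _ = e1 * bi := by rw [hb', one_mul]
  have hac' : ai * c = c * ai := by
    calc ai * c = ai * c * (a * ai) := by rw [ha, mul_one]
      _ = ai * (c * a) * ai := by noncomm_ring
      _ = (ai * a) * c * ai := by rw [← hac]; noncomm_ring
      _ = c * ai := by rw [ha', one_mul]
  have h1 : ai * bi = y * bi + ai * y := by
    calc ai * bi = ai * (a * y + y * b) * bi := by rw [hab, mul_one]
      _ = (ai * a) * y * bi + ai * y * (b * bi) := by noncomm_ring
      _ = y * bi + ai * y := by rw [ha', hb]; noncomm_ring
  have hyb : y * b = 1 - a * y := eq_sub_of_add_eq' hab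
  have h2 : yi * yi * ai * y * b = b * yi * ai := by
    have e1' : ai * (y * b) * a = y * (y * b) * yi := by
      rw [hyb]
      calc ai * (1 - a * y) * a = ai * a - (ai * a) * y * a := by noncomm_ring
        _ = 1 - y * a := by rw [ha']; noncomm_ring
        _ = y * yi - y * a * (y * yi) := by rw [hy]; noncomm_ring
        _ = y * (1 - a * y) * yi := by noncomm_ring
    calc yi * yi * ai * y * b = yi * yi * (ai * (y * b) * a) * ai := by
            rw [show yi * yi * (ai * (y * b) * a) * ai = yi * yi * ai * y * b * (a * ai) by
              noncomm_ring, ha, mul_one]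
      _ = yi * (yi * y) * (y * b * yi) * ai := by rw [e1']; noncomm_ring
      _ = yi * (yi * y) * y * b * yi * ai := by noncomm_ring
      _ = b * yi * ai := by rw [hy', mul_one, hy', one_mul]
  have h3 : y * bi * (yi * yi * ai * y * b) = ai := by
    rw [h2]
    calc y * bi * (b * yi * ai) = y * (bi * b) * yi * ai := by noncomm_ring
      _ = (y * yi) * ai := by rw [hb']; noncomm_ring
      _ = ai := by rw [hy, one_mul]
  have h4 : yi * yi * ai * y - 1 = yi * yi * ai * y * b * y := by
    calc yi * yi * ai * y - 1 = yi * yi * ai * y - yi * (yi * y) * y := by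
          rw [hy', mul_one, hy']
      _ = yi * yi * ai * y - yi * yi * (ai * a) * y * y := by rw [ha']; noncomm_ring
      _ = yi * yi * ai * (1 - a * y) * y := by noncomm_ring
      _ = yi * yi * ai * y * b * y := by rw [← hyb]; noncomm_ring
  have h5 : (1 + y * e1) * bi * (yi * yi * ai * y - 1) = ai * (1 + y * e1) := by
    rw [h4, ← hc]
    calc c * y * bi * (yi * yi * ai * y * b * y) = c * (y * bi * (yi * yi * ai * y * b)) * y := by
          noncomm_ring
      _ = ai * (c * y) := by rw [h3, ← hac']; noncomm_ring
  calc (1 + e1 * y) * bi * (1 + e1 * (yi * yi * ai * y * y))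
      = (1 + e1 * y) * bi + (1 + e1 * y) * (bi * e1) * (yi * yi * ai * y - 1) * y
          + (1 + e1 * y) * (bi * e1) * y := by noncomm_ring
    _ = (1 + e1 * y) * bi + e1 * ((1 + y * e1) * bi * (yi * yi * ai * y - 1)) * y
          + (1 + e1 * y) * (bi * e1) * y := by rw [hbe']; noncomm_ring
    _ = (1 + e1 * y) * bi * (1 + e1 * y) + e1 * (ai * (1 + y * e1)) * y := by
          rw [h5]; noncomm_ring
    _ = bi * (1 + e1 * y) + e1 * (y * bi + ai * y) * (1 + e1 * y) := by noncomm_ring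
    _ = (1 + e1 * ai) * bi * (1 + e1 * y) := by rw [← h1]; noncomm_ring

end alg

/-! ### Part 3: the recursion in `N` in an abstract ring -/

section alg
variable {R : Type*} [Ring R] [Algebra ℚ R]

theorem zl_smul (s : ℚ) (e0 e1 : R) (l : List ℕ) (hl : ∀ x ∈ l, 0 < x) :
    zl (s • e0) (s • e1) l = s ^ l.sum • zl e0 e1 l := by
  induction l with
  | nil => simp [zl]
  | cons k l ih =>
    have hk := hl k (by simp)
    obtain ⟨j, rfl⟩ : ∃ j, k = j + 1 := ⟨k - 1, by omega⟩
    rw [zl, zl, ih (fun x hx => hl x (by simp [hx]))]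
    simp only [Nat.add_sub_cancel, List.sum_cons, smul_pow, smul_mul_assoc, mul_smul_comm,
      smul_smul]
    congr 1
    ring

noncomputable def gs (K : ℕ) (t : ℚ) (x : R) : R :=
  ∑ i ∈ Finset.range (K+1), (1 / t^(i+1)) • x^i

theorem gs_right (K : ℕ) (t : ℚ) (ht : t ≠ 0) (x : R) (hx : x^(K+1) = 0) :
    (t • (1:R) - x) * gs K t x = 1 := by
  have : ∀ n, (t • (1:R) - x) * ∑ i ∈ Finset.range n, (1 / t^(i+1)) • x^i =
      1 - (1 / t^n) • x^n := by
    intro n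
    induction n with
    | zero => simp
    | succ n ih =>
      rw [Finset.sum_range_succ, mul_add, ih, sub_mul, smul_mul_assoc, one_mul, smul_smul,
        mul_smul_comm, ← pow_succ']
      have : t * (1 / t^(n+1)) = 1 / t^n := by rw [pow_succ]; field_simp
      rw [this]
      abel
  rw [gs, this, hx, smul_zero, sub_zero]

theorem gs_left (K : ℕ) (t : ℚ) (ht : t ≠ 0) (x : R) (hx : x^(K+1) = 0) :
    gs K t x * (t • (1:R) - x) = 1 := by
  have : Commute (t • (1:R) - x) (gs K t x) := by
    refine Commute.sub_left ((Commute.one_left _).smul_left t) ?_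
    refine Commute.sum_right _ _ _ fun i _ => ?_
    exact ((Commute.refl x).pow_right i).smul_right _
  exact this.eq.symm.trans (gs_right K t ht x hx)

theorem zconj_pow (y yi e0 : R) (hy : y * yi = 1) (hy' : yi * y = 1) (i : ℕ) :
    (yi * yi * e0 * y * y)^i = yi * yi * e0^i * y * y := by
  induction i with
  | zero =>
    simp only [pow_zero, mul_one]
    rw [mul_assoc yi yi y, hy', mul_one, hy']
  | succ i ih =>
    rw [pow_succ, ih]
    calc yi * yi * e0 ^ i * y * y * (yi * yi * e0 * y * y)
        = yi * yi * e0 ^ i * (y * (y * yi) * yi) * e0 * y * y := by noncomm_ring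
      _ = yi * yi * e0 ^ (i+1) * y * y := by
          rw [hy, mul_one, hy, mul_one, pow_succ]; noncomm_ring

theorem gs_conj (K : ℕ) (t : ℚ) (y yi e0 : R) (hy : y * yi = 1) (hy' : yi * y = 1) :
    gs K t (yi * yi * e0 * y * y) = yi * yi * gs K t e0 * y * y := by
  unfold gs
  simp only [Finset.mul_sum, Finset.sum_mul, zconj_pow y yi e0 hy hy', mul_smul_comm,
    smul_mul_assoc]

theorem Psi_rel' (N M K : ℕ) (hM : 0 < M) (e0 e1 : R)
    (hz : ∀ l : List ℕ, (∀ x ∈ l, 0 < x) → K < l.sum → zl e0 e1 l = 0) (m : ℕ) (hm : m < N) :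
    (1 - ((M:ℚ) / ((N:ℚ) - m)) • e1) * Psi N K ((M:ℚ) • e0) ((M:ℚ) • e1) m =
      (1 + e1 * gs K ((m:ℚ)/M) e0) * Psi N K ((M:ℚ) • e0) ((M:ℚ) • e1) (m+1) := by
  have h := Psi_rel N K ((M:ℚ) • e0) ((M:ℚ) • e1) (by
    intro l hl hs
    rw [zl_smul _ _ _ _ hl, hz l hl hs, smul_zero]) m hm
  have hM' : (M:ℚ) ≠ 0 := by positivity
  have e : ((M:ℚ) • e1) * ∑ i ∈ Finset.range (K+1), (1 / (m:ℚ)^(i+1)) • ((M:ℚ) • e0)^i =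
      e1 * gs K ((m:ℚ)/M) e0 := by
    rw [gs, smul_mul_assoc, ← mul_smul_comm, Finset.smul_sum]
    congr 1
    refine Finset.sum_congr rfl fun i _ => ?_
    rw [smul_pow, smul_smul, smul_smul]
    congr 1
    rw [div_pow, one_div_div, pow_succ (M:ℚ)]
    ring
  rw [e] at h
  rw [← h, sub_mul, one_mul, smul_mul_assoc, smul_mul_assoc, smul_smul]
  congr 3
  ring

theorem Psi_main (N K : ℕ) (hN : 0 < N) (e0 e1 y yi p : R) (hy : y * yi = 1) (hy' : yi * y = 1)
    (hrel : y * (1 - e1) - e0 * y = 1) (hp : e1 * p = 0) (h0 : e0^(K+1) = 0) (h1 : e1^(K+1) = 0)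
    (hz : ∀ l : List ℕ, (∀ x ∈ l, 0 < x) → K < l.sum → zl e0 e1 l = 0)
    (hz' : ∀ l : List ℕ, (∀ x ∈ l, 0 < x) → K < l.sum →
      zl (yi * yi * e0 * y * y) e1 l = 0) :
    (1 - e1) * Psi (N+1) K ((N:ℚ) • e0) ((N:ℚ) • e1) 1 * p =
      (1 + e1 * y) * Psi N K ((N:ℚ) • (yi * yi * e0 * y * y)) ((N:ℚ) • e1) 1 * p := by
  have hN' : (N:ℚ) ≠ 0 := by positivity
  have hrel' : (1 - e0) * y = 1 + y * e1 := by
    have h := hrel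
    rw [mul_sub, mul_one] at h
    calc (1 - e0) * y = (y - y * e1 - e0 * y) + y * e1 := by noncomm_ring
      _ = 1 + y * e1 := by rw [h]
  have claim : ∀ d, d < N →
      (1 - ((N:ℚ) / (((N+1 : ℕ):ℚ) - ((N-d : ℕ):ℚ))) • e1) *
        Psi (N+1) K ((N:ℚ) • e0) ((N:ℚ) • e1) (N-d) * p =
      (1 + e1 * y) * Psi N K ((N:ℚ) • (yi * yi * e0 * y * y)) ((N:ℚ) • e1) (N-d) * p := by
    intro d
    induction d with
    | zero =>
      intro _
      rw [Nat.sub_zero, Psi_rel' (N+1) N K hN e0 e1 hz N (by omega), Psi_top, Psi_top, mul_one,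
        mul_one, div_self hN']
      have hg := gs_left K 1 one_ne_zero e0 h0
      have h2 := hrel'
      have h3 : y * p = gs K 1 e0 * p := by
        calc y * p = gs K 1 e0 * ((1:ℚ) • (1:R) - e0) * (y * p) := by rw [hg, one_mul]
          _ = gs K 1 e0 * (((1 - e0) * y) * p) := by rw [one_smul]; noncomm_ring
          _ = gs K 1 e0 * (p + y * (e1 * p)) := by rw [h2]; noncomm_ring
          _ = gs K 1 e0 * p := by rw [hp, mul_zero, add_zero]
      rw [add_mul, add_mul, mul_assoc, mul_assoc, h3]
    | succ d ih =>
      intro hd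
      have ih := ih (by omega)
      obtain ⟨m, hm⟩ : ∃ m, m = N - (d+1) := ⟨_, rfl⟩
      have hm1 : N - d = m + 1 := by omega
      rw [hm1] at ih
      rw [← hm]
      have hmN : m < N := by omega
      have hmpos : 0 < m := by omega
      have hmN' : (N:ℚ) - m ≠ 0 := by
        have : (m:ℚ) < N := by exact_mod_cast hmN
        linarith
      obtain ⟨t, ht⟩ : ∃ t : ℚ, t = (m:ℚ)/N := ⟨_, rfl⟩
      have ht0 : t ≠ 0 := by rw [ht]; positivity
      have ht1 : 1 - t = ((N:ℚ) - m)/N := by rw [ht]; field_simp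
      have ht1' : 1 - t ≠ 0 := by rw [ht1]; exact div_ne_zero hmN' hN'
      rw [Psi_rel' (N+1) N K hN e0 e1 hz m (by omega), ← ht]
      have hr := Psi_rel' N N K hN (yi * yi * e0 * y * y) e1 hz' m hmN
      rw [← ht, gs_conj K t y yi e0 hy hy'] at hr
      have hU : (1:R) - ((N:ℚ) / ((N:ℚ) - m)) • e1 = (1/(1-t)) • ((1-t) • (1:R) - e1) := by
        rw [smul_sub, smul_smul, one_div_mul_cancel ht1', one_smul, ht1, one_div_div]
      have hU2 : (((N+1 : ℕ):ℚ) - ((m+1 : ℕ):ℚ)) = (N:ℚ) - m := by push_cast; ring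
      rw [hU2, hU] at ih
      rw [hU] at hr
      have key := key_alg e1 y yi (t • (1:R) - e0) (gs K t e0) ((1-t) • (1:R) - e1)
        (gs K (1-t) e1) (1 - e0) hy hy' (gs_right K t ht0 e0 h0) (gs_left K t ht0 e0 h0)
        (gs_right K (1-t) ht1' e1 h1) (gs_left K (1-t) ht1' e1 h1)
        (by
          refine Eq.trans ?_ hrel
          simp only [sub_mul, mul_sub, smul_mul_assoc, mul_smul_comm, sub_smul, one_smul,
            one_mul, mul_one]
          abel)
        (by simp only [sub_mul, mul_sub, smul_mul_assoc, mul_smul_comm, one_mul, mul_one])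
        hrel'
        (by
          simp only [sub_mul, mul_sub, smul_mul_assoc, mul_smul_comm, one_mul, mul_one, smul_sub]
          abel)
      have hbl := gs_left K (1-t) ht1' e1 h1
      generalize gs K (1-t) e1 = bi at *
      generalize gs K t e0 = ai at *
      generalize (1-t) • (1:R) - e1 = b at *
      generalize Psi (N+1) K ((N:ℚ) • e0) ((N:ℚ) • e1) (m+1) = A at *
      generalize Psi N K ((N:ℚ) • (yi * yi * e0 * y * y)) ((N:ℚ) • e1) (m+1) = B at *
      generalize Psi N K ((N:ℚ) • (yi * yi * e0 * y * y)) ((N:ℚ) • e1) m = C at *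
      have hA : A * p = (1-t) • (bi * (1 + e1 * y) * B * p) := by
        calc A * p = (bi * b) * A * p := by rw [hbl, one_mul]
          _ = (1-t) • (bi * ((1/(1-t)) • b * A * p)) := by
              simp only [smul_mul_assoc, mul_smul_comm, smul_smul]
              rw [mul_one_div_cancel ht1', one_smul]; noncomm_ring
          _ = _ := by rw [ih]; noncomm_ring
      have hC : C = (1-t) • (bi * (1 + e1 * (yi * yi * ai * y * y)) * B) := by
        calc C = (bi * b) * C := by rw [hbl, one_mul]
          _ = (1-t) • (bi * ((1/(1-t)) • b * C)) := by
              simp only [smul_mul_assoc, mul_smul_comm, smul_smul]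
              rw [mul_one_div_cancel ht1', one_smul]; noncomm_ring
          _ = _ := by rw [hr]; noncomm_ring
      calc (1 + e1 * ai) * A * p = (1 + e1 * ai) * (A * p) := by rw [mul_assoc]
        _ = (1-t) • (((1 + e1 * ai) * bi * (1 + e1 * y)) * B * p) := by
            rw [hA, mul_smul_comm]; congr 1; noncomm_ring
        _ = _ := by
            rw [← key, hC, mul_smul_comm, smul_mul_assoc]; congr 1; noncomm_ring
  have := claim (N-1) (by omega)
  have e : N - (N-1) = 1 := by omega
  rw [e] at this
  have e2 : ((N:ℚ) / (((N+1 : ℕ):ℚ) - ((1:ℕ):ℚ))) = 1 := by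
    push_cast; rw [add_sub_cancel_right, div_self hN']
  rw [e2, one_smul] at this
  exact this

end alg

/-! ### Part 4: the concrete nilpotent matrix ring -/

section filt
variable {R : Type*} [Ring R] [Algebra ℚ R]

structure IsFilt (F : ℕ → Submodule ℚ R) : Prop where
  one : (1:R) ∈ F 0
  mul : ∀ {m n : ℕ} {a b : R}, a ∈ F m → b ∈ F n → a * b ∈ F (m+n)
  anti : ∀ {m n : ℕ} {a : R}, m ≤ n → a ∈ F n → a ∈ F m

variable {F : ℕ → Submodule ℚ R} (hF : IsFilt F)

theorem IsFilt.pow (hF : IsFilt F) {a : R} (ha : a ∈ F 1) (n : ℕ) : a^n ∈ F n := by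
  induction n with
  | zero => rw [pow_zero]; exact hF.one
  | succ n ih => rw [pow_succ]; exact hF.mul ih ha

theorem IsFilt.pow0 (hF : IsFilt F) {a : R} (ha : a ∈ F 0) (n : ℕ) : a^n ∈ F 0 := by
  induction n with
  | zero => rw [pow_zero]; exact hF.one
  | succ n ih => rw [pow_succ]; exact hF.mul ih ha

theorem IsFilt.zl (hF : IsFilt F) {e0 e1 : R} (h0 : e0 ∈ F 1) (h1 : e1 ∈ F 1) (l : List ℕ)
    (hl : ∀ x ∈ l, 0 < x) : zl e0 e1 l ∈ F l.sum := by
  induction l with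
  | nil => exact hF.one
  | cons k l ih =>
    have hk := hl k (by simp)
    rw [_root_.zl]
    refine hF.anti ?_ (hF.mul (hF.mul h1 (hF.pow h0 (k-1))) (ih fun x hx => hl x (by simp [hx])))
    rw [List.sum_cons]; omega

theorem IsFilt.gs (hF : IsFilt F) {a : R} (ha : a ∈ F 1) (K : ℕ) : gs K 1 a ∈ F 0 := by
  unfold _root_.gs
  refine Submodule.sum_mem _ fun i _ => Submodule.smul_mem _ _ (hF.anti (Nat.zero_le i) (hF.pow ha i))

noncomputable def yel (K : ℕ) (e0 e1 : R) : R :=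
  ∑ i ∈ Finset.range (K+1), e0^i * (gs K 1 e1)^(i+1)

theorem yel_rel (K : ℕ) (e0 e1 : R) (h0 : e0^(K+1) = 0) (h1 : e1^(K+1) = 0) :
    yel K e0 e1 * (1 - e1) - e0 * yel K e0 e1 = 1 := by
  have hg := gs_left K 1 one_ne_zero e1 h1
  rw [one_smul] at hg
  unfold yel
  generalize gs K 1 e1 = g at *
  have : ∀ n, (∑ i ∈ Finset.range n, e0^i * g^(i+1)) * (1 - e1) -
      e0 * (∑ i ∈ Finset.range n, e0^i * g^(i+1)) = 1 - e0^n * g^n := by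
    intro n
    induction n with
    | zero => simp
    | succ n ih =>
      rw [Finset.sum_range_succ, add_mul, mul_add]
      have e : e0^n * g^(n+1) * (1 - e1) = e0^n * g^n := by
        rw [pow_succ, mul_assoc, mul_assoc, hg, mul_one]
      rw [e, ← mul_assoc, ← pow_succ', add_sub_add_comm, ih]
      abel
  rw [this, h0, zero_mul, sub_zero]

/-- Everything about the second-order expansion needed later. -/
theorem IsFilt.main (hF : IsFilt F) {e0 e1 g y yi : R} (h0 : e0 ∈ F 1) (h1 : e1 ∈ F 1)
    (hg : g ∈ F 0) (hge : (1 - e1) * g = 1) (hyF : y ∈ F 0) (hyiF : yi ∈ F 0)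
    (hrel : y * (1 - e1) - e0 * y = 1) (hy : y * yi = 1) (hy' : yi * y = 1)
    (l : List ℕ) (hl : ∀ x ∈ l, 0 < x) :
    (g * (1 + e1 * y)) * _root_.zl (yi * yi * e0 * y * y) e1 l
      - _root_.zl e0 e1 l * (1 + (2:ℚ) • e1) ∈ F (l.sum + 2) := by
  have g1 : g - 1 = e1 * g := by
    calc g - 1 = ((1 - e1) * g + e1 * g) - 1 := by noncomm_ring
      _ = e1 * g := by rw [hge]; abel
  have g1F : g - 1 ∈ F 1 := by rw [g1]; exact hF.mul h1 hg
  have g2F : g - 1 - e1 ∈ F 2 := by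
    have : g - 1 - e1 = e1 * (g - 1) := by
      calc g - 1 - e1 = e1 * g - e1 := by rw [g1]
        _ = _ := by noncomm_ring
    rw [this]; exact hF.mul h1 g1F
  have yeq : y = g + e0 * y * g := by
    calc y = y * ((1 - e1) * g) := by rw [hge, mul_one]
      _ = (y * (1 - e1) - e0 * y) * g + e0 * y * g := by noncomm_ring
      _ = _ := by rw [hrel, one_mul]
  have hyg : e0 * y * g ∈ F 1 := hF.mul (hF.mul h0 hyF) hg
  have y1F : y - 1 ∈ F 1 := by
    have : y - 1 = (g - 1) + e0 * y * g := by nth_rewrite 1 [yeq]; abel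
    rw [this]; exact Submodule.add_mem _ g1F hyg
  have y2F : y - 1 - e0 - e1 ∈ F 2 := by
    have : y - 1 - e0 - e1 = (g - 1 - e1) + e0 * ((y - 1) * g + (g - 1)) := by
      nth_rewrite 1 [yeq]; noncomm_ring
    rw [this]
    exact Submodule.add_mem _ g2F (hF.mul h0 (Submodule.add_mem _ (hF.mul y1F hg) g1F))
  obtain ⟨f, hf⟩ : ∃ f, f = yi * yi * e0 * y * y := ⟨_, rfl⟩
  rw [← hf]
  have fF : f ∈ F 1 := by
    rw [hf]
    exact hF.mul (hF.mul (hF.mul (hF.mul hyiF hyiF) h0) hyF) hyF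
  have hcomm : y * y * f = e0 * (y * y) := by
    rw [hf]
    calc y * y * (yi * yi * e0 * y * y) = y * (y * yi) * yi * e0 * y * y := by noncomm_ring
      _ = _ := by rw [hy, mul_one, hy, one_mul]; noncomm_ring
  obtain ⟨u, hu⟩ : ∃ u, u = y * y - 1 := ⟨_, rfl⟩
  have uF : u ∈ F 1 := by
    have : u = (y - 1) * y + (y - 1) := by rw [hu]; noncomm_ring
    rw [this]; exact Submodule.add_mem _ (hF.mul y1F hyF) y1F
  obtain ⟨r, hr⟩ : ∃ r, r = u - (2:ℚ) • (e0 + e1) := ⟨_, rfl⟩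
  have rF : r ∈ F 2 := by
    have : r = (y - 1) * (y - 1) + (2:ℚ) • (y - 1 - e0 - e1) := by
      rw [hr, hu, two_smul, two_smul]; noncomm_ring
    rw [this]
    exact Submodule.add_mem _ (hF.mul y1F y1F) (Submodule.smul_mem _ _ y2F)
  have fe : f - e0 = e0 * u - u * f := by
    have : y * y = 1 + u := by rw [hu]; abel
    rw [this] at hcomm
    calc f - e0 = (1 + u) * f - u * f - e0 := by noncomm_ring
      _ = _ := by rw [hcomm]; noncomm_ring
  have feF : f - e0 ∈ F 2 := by
    rw [fe]; exact Submodule.sub_mem _ (hF.mul h0 uF) (hF.mul uF fF)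
  obtain ⟨h, hh⟩ : ∃ h, h = 1 + (2:ℚ) • e1 := ⟨_, rfl⟩
  have hu' : u = (2:ℚ) • (e0 + e1) + r := by rw [hr]; abel
  have hcF : h * f - e0 * h ∈ F 3 := by
    have : h * f - e0 * h = -((2:ℚ) • (e0 * (f - e0))) + e0 * r - r * f := by
      calc h * f - e0 * h = (f - e0) + (2:ℚ) • (e1 * f) - (2:ℚ) • (e0 * e1) := by
            rw [hh, two_smul, two_smul, two_smul]; noncomm_ring
        _ = (e0 * u - u * f) + (2:ℚ) • (e1 * f) - (2:ℚ) • (e0 * e1) := by rw [fe]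
        _ = _ := by
            rw [hu']; simp only [two_smul]; noncomm_ring
    rw [this]
    exact Submodule.sub_mem _ (Submodule.add_mem _ (Submodule.neg_mem _
      (Submodule.smul_mem _ _ (hF.mul h0 feF))) (hF.mul h0 rF)) (hF.mul rF fF)
  have hcpow : ∀ i, h * f^i - e0^i * h ∈ F (i+2) := by
    intro i
    induction i with
    | zero => simp
    | succ i ih =>
      have : h * f^(i+1) - e0^(i+1) * h =
          (h * f^i - e0^i * h) * f + e0^i * (h * f - e0 * h) := by
        rw [pow_succ, pow_succ]; noncomm_ring
      rw [this]
      refine Submodule.add_mem _ (hF.anti ?_ (hF.mul ih fF))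
        (hF.anti ?_ (hF.mul (hF.pow h0 i) hcF)) <;> omega
  have he1 : h * e1 = e1 * h := by rw [hh, two_smul]; noncomm_ring
  have hzl : h * _root_.zl f e1 l - _root_.zl e0 e1 l * h ∈ F (l.sum + 2) := by
    induction l with
    | nil => simp [_root_.zl]
    | cons k l ih =>
      have hk := hl k (by simp)
      have hl' : ∀ x ∈ l, 0 < x := fun x hx => hl x (by simp [hx])
      have ih := ih hl'
      rw [_root_.zl, _root_.zl]
      have hZ := hF.zl fF h1 l hl'
      generalize _root_.zl f e1 l = Z' at *
      generalize _root_.zl e0 e1 l = Z at *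
      have : h * (e1 * f^(k-1) * Z') - e1 * e0^(k-1) * Z * h =
          e1 * ((h * f^(k-1) - e0^(k-1) * h) * Z' + e0^(k-1) * (h * Z' - Z * h)) := by
        calc h * (e1 * f^(k-1) * Z') - e1 * e0^(k-1) * Z * h
            = (h * e1) * (f^(k-1) * Z') - e1 * e0^(k-1) * Z * h := by noncomm_ring
          _ = _ := by rw [he1]; noncomm_ring
      rw [this]
      have q : e1 * ((h * f^(k-1) - e0^(k-1) * h) * Z' + e0^(k-1) * (h * Z' - Z * h)) ∈
          F (1 + (k - 1 + 2 + l.sum)) := by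
        refine hF.mul h1 (Submodule.add_mem _ (hF.mul (hcpow _) hZ) (hF.anti ?_
          (hF.mul (hF.pow h0 _) ih)))
        omega
      refine hF.anti ?_ q
      rw [List.sum_cons]; omega
  have GF : g * (1 + e1 * y) - h ∈ F 2 := by
    have : g * (1 + e1 * y) - h = (g - 1 - e1) + ((g - 1) * e1 * y + e1 * (y - 1)) := by
      rw [hh, two_smul]; noncomm_ring
    rw [this]
    exact Submodule.add_mem _ g2F (Submodule.add_mem _ (hF.mul (hF.mul g1F h1) hyF)
      (hF.mul h1 y1F))
  rw [← hh]
  have : g * (1 + e1 * y) * _root_.zl f e1 l - _root_.zl e0 e1 l * h =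
      (g * (1 + e1 * y) - h) * _root_.zl f e1 l +
        (h * _root_.zl f e1 l - _root_.zl e0 e1 l * h) := by noncomm_ring
  rw [this]
  refine Submodule.add_mem _ (hF.anti ?_ (hF.mul GF (hF.zl fF h1 l hl))) hzl
  omega

theorem zl_append (e0 e1 : R) (l l' : List ℕ) :
    zl e0 e1 (l ++ l') = zl e0 e1 l * zl e0 e1 l' := by
  induction l with
  | nil => simp [zl]
  | cons k l ih => simp only [List.cons_append, zl, ih, mul_assoc]

end filt

section mat

abbrev WW (K : ℕ) : Type := {w : List Bool // w.length ≤ K}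

theorem WW_finite (K : ℕ) : Finite (WW K) := (List.finite_length_le Bool K).to_subtype

noncomputable instance WW_fintype (K : ℕ) : Fintype (WW K) :=
  @Fintype.ofFinite _ (WW_finite K)

abbrev MM (K : ℕ) : Type := Matrix (WW K) (WW K) ℚ

def wnil (K : ℕ) : WW K := ⟨[], by simp⟩

noncomputable def EE (K : ℕ) (b : Bool) : MM K := fun i j =>
  if i.1 = b :: j.1 ∧ (b = true → j.1 ≠ []) then 1 else 0

noncomputable def pp (K : ℕ) : MM K := fun i j => if i = wnil K ∧ j = wnil K then 1 else 0

noncomputable def FF (K m : ℕ) : Submodule ℚ (MM K) where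
  carrier := {A | ∀ i j, A i j ≠ 0 → j.1.length + m ≤ i.1.length}
  add_mem' := by
    intro a b ha hb i j h
    by_cases h1 : a i j = 0
    · by_cases h2 : b i j = 0
      · exact absurd (by rw [Matrix.add_apply, h1, h2, add_zero]) h
      · exact hb i j h2
    · exact ha i j h1
  zero_mem' := by intro i j h; exact absurd rfl h
  smul_mem' := by
    intro c a ha i j h
    refine ha i j fun h1 => h ?_
    rw [Matrix.smul_apply, h1, smul_zero]

theorem mem_FF {K m : ℕ} {A : MM K} :
    A ∈ FF K m ↔ ∀ i j, A i j ≠ 0 → j.1.length + m ≤ i.1.length := Iff.rfl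

theorem FF_filt (K : ℕ) : IsFilt (FF K) where
  one := by
    rw [mem_FF]
    intro i j h
    by_cases hij : i = j
    · rw [hij]; simp
    · exact absurd (Matrix.one_apply_ne hij) h
  mul := by
    intro m n a b ha hb
    rw [mem_FF] at *
    intro i j h
    rw [Matrix.mul_apply] at h
    obtain ⟨t, _, ht⟩ := Finset.exists_ne_zero_of_sum_ne_zero h
    have h1 := ha i t (left_ne_zero_of_mul ht)
    have h2 := hb t j (right_ne_zero_of_mul ht)
    omega
  anti := by
    intro m n a hmn ha
    rw [mem_FF] at *
    intro i j h
    have := ha i j h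
    omega

theorem FF_top {K m : ℕ} (hm : K < m) {A : MM K} (hA : A ∈ FF K m) : A = 0 := by
  ext i j
  by_contra h
  have := mem_FF.mp hA i j h
  have := i.2
  omega

theorem EE_mem (K : ℕ) (b : Bool) : EE K b ∈ FF K 1 := by
  rw [mem_FF]
  intro i j h
  unfold EE at h
  split_ifs at h with h1
  · rw [h1.1]; simp
  · exact absurd rfl h

theorem EE_p (K : ℕ) : EE K true * pp K = 0 := by
  ext i j
  rw [Matrix.mul_apply]
  refine Finset.sum_eq_zero fun t _ => ?_
  unfold EE pp
  by_cases ht : t = wnil K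
  · have : t.1 = [] := by rw [ht]; rfl
    simp [this]
  · simp [ht]

theorem mul_pp (K : ℕ) (A : MM K) (i : WW K) : (A * pp K) i (wnil K) = A i (wnil K) := by
  rw [Matrix.mul_apply, Finset.sum_eq_single (wnil K)]
  · simp [pp]
  · intro t _ ht; simp [pp, ht]
  · intro h; exact absurd (Finset.mem_univ _) h

/-- The word attached to an index. -/
def wd : List ℕ → List Bool
  | [] => []
  | k :: l => true :: (List.replicate (k-1) false ++ wd l)

noncomputable def wm (K : ℕ) : List Bool → MM K
  | [] => 1
  | b :: w => EE K b * wm K w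

theorem wm_rep (K n : ℕ) (w : List Bool) :
    wm K (List.replicate n false ++ w) = (EE K false)^n * wm K w := by
  induction n with
  | zero => simp
  | succ n ih =>
    rw [List.replicate_succ, List.cons_append, wm, ih, pow_succ', mul_assoc]

theorem zl_eq_wm (K : ℕ) (l : List ℕ) : zl (EE K false) (EE K true) l = wm K (wd l) := by
  induction l with
  | nil => rfl
  | cons k l ih => rw [zl, wd, wm, wm_rep, ih, mul_assoc]

theorem wm_apply (K : ℕ) (w : List Bool) : ∀ κ : WW K, κ.1.getLast? ≠ some true →
    wm K w κ (wnil K) = if κ.1 = w then 1 else 0 := by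
  induction w with
  | nil =>
    intro κ _
    rw [wm, Matrix.one_apply]
    refine if_congr ?_ rfl rfl
    rw [Subtype.ext_iff]; rfl
  | cons b w ih =>
    rintro ⟨κ, hκ⟩ hlast
    rw [wm, Matrix.mul_apply]
    cases κ with
    | nil =>
      rw [if_neg (by simp)]
      exact Finset.sum_eq_zero fun t _ => by simp [EE]
    | cons b' κ =>
      by_cases hb : b' = b
      · subst hb
        have hκ' : κ.length ≤ K := by simp at hκ; omega
        have h1 : b' = true → κ ≠ [] := by
          rintro rfl rfl
          simp at hlast
        have h2 : κ.getLast? ≠ some true := by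
          cases κ with
          | nil => simp
          | cons a κ => simpa [List.getLast?_cons_cons] using hlast
        rw [Finset.sum_eq_single (⟨κ, hκ'⟩ : WW K)]
        · rw [ih ⟨κ, hκ'⟩ h2]
          have : EE K b' ⟨b' :: κ, hκ⟩ ⟨κ, hκ'⟩ = 1 := by
            unfold EE
            exact if_pos ⟨rfl, h1⟩
          rw [this, one_mul]
          simp
        · rintro ⟨t, ht'⟩ _ ht
          have : EE K b' ⟨b' :: κ, hκ⟩ ⟨t, ht'⟩ = 0 := by
            unfold EE
            refine if_neg fun h => ht ?_
            have := h.1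
            simp at this
            exact Subtype.ext this.symm
          rw [this, zero_mul]
        · intro h; exact absurd (Finset.mem_univ _) h
      · rw [if_neg (by simp [hb])]
        exact Finset.sum_eq_zero fun t _ => by simp [EE, hb]

def wlead : List Bool → ℕ
  | [] => 0
  | true :: _ => 0
  | false :: w => wlead w + 1

def wdec : List Bool → List ℕ
  | [] => []
  | true :: w => (wlead w + 1) :: wdec w
  | false :: w => wdec w

theorem wlead_rep (n : ℕ) (w : List Bool) : wlead (List.replicate n false ++ w) = n + wlead w := by
  induction n with
  | zero => simp
  | succ n ih => rw [List.replicate_succ, List.cons_append, wlead, ih]; omega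

theorem wdec_rep (n : ℕ) (w : List Bool) : wdec (List.replicate n false ++ w) = wdec w := by
  induction n with
  | zero => simp
  | succ n ih => rw [List.replicate_succ, List.cons_append, wdec, ih]

theorem wlead_wd (l : List ℕ) : wlead (wd l) = 0 := by
  cases l <;> rfl

theorem wdec_wd (l : List ℕ) (hl : ∀ x ∈ l, 0 < x) : wdec (wd l) = l := by
  induction l with
  | nil => rfl
  | cons k l ih =>
    have := hl k (by simp)
    rw [wd, wdec, wlead_rep, wdec_rep, wlead_wd, ih fun x hx => hl x (by simp [hx])]
    congr 1; omega

theorem wd_length (l : List ℕ) (hl : ∀ x ∈ l, 0 < x) : (wd l).length = l.sum := by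
  induction l with
  | nil => rfl
  | cons k l ih =>
    have := hl k (by simp)
    simp [wd, ih fun x hx => hl x (by simp [hx])]
    omega

theorem wd_append (l l' : List ℕ) : wd (l ++ l') = wd l ++ wd l' := by
  induction l with
  | nil => rfl
  | cons k l ih => simp [wd, ih]

theorem wd_last (l : List ℕ) (m : ℕ) (hm : 2 ≤ m) : (wd (l ++ [m])).getLast? ≠ some true := by
  obtain ⟨n, rfl⟩ : ∃ n, m = n + 2 := ⟨m - 2, by omega⟩
  have : wd (l ++ [n+2]) = (wd l ++ (true :: List.replicate n false)) ++ [false] := by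
    rw [wd_append]
    simp [wd, List.replicate_succ']
  rw [this, List.getLast?_append]
  simp

theorem EE_int (K : ℕ) (b : Bool) :
    EE K b ∈ ((Int.castRingHom ℚ).mapMatrix (m := WW K)).range := by
  refine ⟨fun i j => if i.1 = b :: j.1 ∧ (b = true → j.1 ≠ []) then 1 else 0, ?_⟩
  ext i j
  change (Int.castRingHom ℚ) (if i.1 = b :: j.1 ∧ (b = true → j.1 ≠ []) then 1 else 0) = _
  unfold EE
  split_ifs
  · exact map_one _
  · exact map_zero _

theorem gs_int {K : ℕ} {S : Subring (MM K)} {a : MM K} (ha : a ∈ S) (n : ℕ) : gs n 1 a ∈ S := by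
  unfold gs
  refine Subring.sum_mem _ fun i _ => ?_
  rw [one_pow, div_one, one_smul]
  exact Subring.pow_mem _ ha _

theorem zl_int {K : ℕ} {S : Subring (MM K)} {a b : MM K} (ha : a ∈ S) (hb : b ∈ S) (l : List ℕ) :
    zl a b l ∈ S := by
  induction l with
  | nil => exact Subring.one_mem _
  | cons k l ih => exact Subring.mul_mem _ (Subring.mul_mem _ hb (Subring.pow_mem _ ha _)) ih

theorem Psi_entry (N M K : ℕ) (e0 e1 G : MM K) (i : WW K) :
    (G * Psi N K ((M:ℚ) • e0) ((M:ℚ) • e1) 1 * pp K) i (wnil K) =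
      ∑ j ∈ Finset.range (K+1), ∑ l ∈ comps j,
        (M:ℚ)^j * (G * zl e0 e1 l * pp K) i (wnil K) * Qd N l 1 := by
  unfold Psi
  simp only [Finset.mul_sum, Finset.sum_mul, Matrix.sum_apply]
  refine Finset.sum_congr rfl fun j _ => Finset.sum_congr rfl fun l hl => ?_
  rw [mem_comps] at hl
  rw [zl_smul _ _ _ _ hl.2, hl.1, mul_smul_comm, mul_smul_comm, smul_mul_assoc, smul_mul_assoc,
    Matrix.smul_apply, Matrix.smul_apply, smul_eq_mul, smul_eq_mul]
  ring

theorem recN (K : ℕ) (κ : List ℕ) (hpos : ∀ x ∈ κ, 0 < x) (hs : κ.sum = K + 2)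
    (hlast : ∃ l0 m, κ = l0 ++ [m] ∧ 2 ≤ m) :
    ∃ c : List ℕ → ℤ, (∀ l, c (l ++ [1]) = 0) ∧ ∀ N : ℕ, 0 < N →
      (N:ℚ)^(K+2) * Qd (N+1) κ 1 = (N:ℚ)^(K+2) * Qd N κ 1 +
        ∑ j ∈ Finset.range (K+1), ∑ l ∈ comps j, (N:ℚ)^j * c l * Qd N l 1 := by
  obtain ⟨e0, he0⟩ : ∃ e, e = EE (K+2) false := ⟨_, rfl⟩
  obtain ⟨e1, he1⟩ : ∃ e, e = EE (K+2) true := ⟨_, rfl⟩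
  obtain ⟨S, hS⟩ : ∃ S, S = ((Int.castRingHom ℚ).mapMatrix (m := WW (K+2))).range := ⟨_, rfl⟩
  have e0S : e0 ∈ S := by rw [hS, he0]; exact EE_int _ _
  have e1S : e1 ∈ S := by rw [hS, he1]; exact EE_int _ _
  have hF := FF_filt (K+2)
  have e0F : e0 ∈ FF (K+2) 1 := by rw [he0]; exact EE_mem _ _
  have e1F : e1 ∈ FF (K+2) 1 := by rw [he1]; exact EE_mem _ _
  have h0 : e0^(K+2+1) = 0 := FF_top (by omega) (hF.pow e0F _)
  have h1 : e1^(K+2+1) = 0 := FF_top (by omega) (hF.pow e1F _)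
  have hp : e1 * pp (K+2) = 0 := by rw [he1]; exact EE_p _
  obtain ⟨g, hg⟩ : ∃ g, g = gs (K+2) 1 e1 := ⟨_, rfl⟩
  have gF : g ∈ FF (K+2) 0 := by rw [hg]; exact hF.gs e1F _
  have gS : g ∈ S := by rw [hg]; exact gs_int e1S _
  have hge : (1 - e1) * g = 1 := by
    have := gs_right (K+2) 1 one_ne_zero e1 h1
    rwa [one_smul, ← hg] at this
  have hge' : g * (1 - e1) = 1 := by
    have := gs_left (K+2) 1 one_ne_zero e1 h1
    rwa [one_smul, ← hg] at this
  obtain ⟨y, hy⟩ : ∃ y, y = yel (K+2) e0 e1 := ⟨_, rfl⟩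
  have hrel := yel_rel (K+2) e0 e1 h0 h1
  rw [← hy] at hrel
  have yF : y ∈ FF (K+2) 0 := by
    rw [hy]
    unfold yel
    rw [← hg]
    exact Submodule.sum_mem _ fun i _ => hF.anti (Nat.zero_le _) (hF.mul (hF.pow e0F _)
      (hF.pow0 gF _))
  have yS : y ∈ S := by
    rw [hy]
    unfold yel
    rw [← hg]
    exact Subring.sum_mem _ fun i _ => Subring.mul_mem _ (Subring.pow_mem _ e0S _)
      (Subring.pow_mem _ gS _)
  have y1F : 1 - y ∈ FF (K+2) 1 := by
    have : 1 - y = -(e0 * y + y * e1) := by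
      calc 1 - y = (y * (1 - e1) - e0 * y) - y + (1 - (y * (1 - e1) - e0 * y)) := by abel
        _ = (y * (1 - e1) - e0 * y) - y := by rw [hrel, sub_self, add_zero]
        _ = _ := by noncomm_ring
    rw [this]
    exact Submodule.neg_mem _ (Submodule.add_mem _ (hF.mul e0F yF)
      (hF.mul yF e1F))
  have h1y : (1 - y)^(K+2+1) = 0 := FF_top (by omega) (hF.pow y1F _)
  obtain ⟨yi, hyi⟩ : ∃ yi, yi = gs (K+2) 1 (1 - y) := ⟨_, rfl⟩
  have yiF : yi ∈ FF (K+2) 0 := by rw [hyi]; exact hF.gs y1F _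
  have yiS : yi ∈ S := by rw [hyi]; exact gs_int (Subring.sub_mem _ (Subring.one_mem _) yS) _
  have hyyi : y * yi = 1 := by
    have := gs_right (K+2) 1 one_ne_zero (1-y) h1y
    rwa [one_smul, ← hyi, sub_sub_cancel] at this
  have hyiy : yi * y = 1 := by
    have := gs_left (K+2) 1 one_ne_zero (1-y) h1y
    rwa [one_smul, ← hyi, sub_sub_cancel] at this
  obtain ⟨f, hf⟩ : ∃ f, f = yi * yi * e0 * y * y := ⟨_, rfl⟩
  have fF : f ∈ FF (K+2) 1 := by
    rw [hf]
    exact hF.mul (hF.mul (hF.mul (hF.mul yiF yiF) e0F) yF) yF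
  have fS : f ∈ S := by
    rw [hf]
    exact Subring.mul_mem _ (Subring.mul_mem _ (Subring.mul_mem _ (Subring.mul_mem _ yiS yiS)
      e0S) yS) yS
  obtain ⟨G, hG⟩ : ∃ G, G = g * (1 + e1 * y) := ⟨_, rfl⟩
  have GS : G ∈ S := by
    rw [hG]
    exact Subring.mul_mem _ gS (Subring.add_mem _ (Subring.one_mem _) (Subring.mul_mem _ e1S yS))
  have hmain : ∀ l : List ℕ, (∀ x ∈ l, 0 < x) → K + 1 ≤ l.sum →
      G * zl f e1 l * pp (K+2) = zl e0 e1 l * pp (K+2) := by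
    intro l hl hsl
    have := hF.main e0F e1F gF hge yF yiF hrel hyyi hyiy l hl
    rw [← hf, ← hG] at this
    have := sub_eq_zero.mp (FF_top (by omega) this)
    rw [this, mul_assoc, add_mul, smul_mul_assoc, hp, smul_zero, add_zero, one_mul]
  have hCex : ∀ l, ∃ C : Matrix (WW (K+2)) (WW (K+2)) ℤ,
      (Int.castRingHom ℚ).mapMatrix C = G * zl f e1 l := by
    intro l
    have : G * zl f e1 l ∈ S := Subring.mul_mem _ GS (zl_int fS e1S l)
    rw [hS] at this
    exact this
  choose C hC using hCex
  have hκlen : (wd κ).length ≤ K + 2 := by rw [wd_length κ hpos, hs]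
  obtain ⟨i, hi⟩ : ∃ i : WW (K+2), i = ⟨wd κ, hκlen⟩ := ⟨_, rfl⟩
  have hi1 : i.1 = wd κ := by rw [hi]
  have hilast : i.1.getLast? ≠ some true := by
    obtain ⟨l0, m, rfl, hm⟩ := hlast
    rw [hi1]; exact wd_last l0 m hm
  have hCe : ∀ l, (G * zl f e1 l * pp (K+2)) i (wnil _) = (C l i (wnil _) : ℚ) := by
    intro l
    rw [mul_pp, ← hC l]; rfl
  have hZ : ∀ l : List ℕ, (∀ x ∈ l, 0 < x) →
      (zl e0 e1 l * pp (K+2)) i (wnil _) = if l = κ then 1 else 0 := by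
    intro l hl
    rw [mul_pp, he0, he1, zl_eq_wm, wm_apply _ _ _ hilast, hi1]
    refine if_congr ⟨fun h => ?_, fun h => by rw [h]⟩ rfl rfl
    rw [← wdec_wd l hl, ← h, wdec_wd κ hpos]
  refine ⟨fun l => C l i (wnil _), ?_, ?_⟩
  · intro l
    have := hCe (l ++ [1])
    rw [zl_append] at this
    have e : zl f e1 [1] = e1 := by simp [zl]
    rw [e, mul_assoc, mul_assoc, hp, mul_zero, mul_zero, Matrix.zero_apply] at this
    exact_mod_cast this.symm
  · intro N hN
    have hm := Psi_main N (K+2) hN e0 e1 y yi (pp (K+2)) hyyi hyiy hrel hp h0 h1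
      (fun l hl hlt => FF_top hlt (hF.zl e0F e1F l hl))
      (by
        rw [← hf]
        exact fun l hl hlt => FF_top hlt (hF.zl fF e1F l hl))
    rw [← hf] at hm
    have hm2 : 1 * Psi (N+1) (K+2) ((N:ℚ) • e0) ((N:ℚ) • e1) 1 * pp (K+2) =
        G * Psi N (K+2) ((N:ℚ) • f) ((N:ℚ) • e1) 1 * pp (K+2) := by
      rw [← hge', hG]
      calc g * (1 - e1) * Psi (N+1) (K+2) ((N:ℚ) • e0) ((N:ℚ) • e1) 1 * pp (K+2)
          = g * ((1 - e1) * Psi (N+1) (K+2) ((N:ℚ) • e0) ((N:ℚ) • e1) 1 * pp (K+2)) := by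
            simp only [mul_assoc]
        _ = _ := by rw [hm]; simp only [mul_assoc]
    have hm3 := congrFun (congrFun hm2 i) (wnil _)
    rw [Psi_entry, Psi_entry] at hm3
    have sumδ : ∀ (M j : ℕ), ∑ l ∈ comps j, (N:ℚ)^j * (if l = κ then 1 else 0) * Qd M l 1 =
        if j = K + 2 then (N:ℚ)^(K+2) * Qd M κ 1 else 0 := by
      intro M j
      split_ifs with hj
      · rw [Finset.sum_eq_single κ]
        · rw [if_pos rfl, mul_one, hj]
        · intro l _ hl; rw [if_neg hl, mul_zero, zero_mul]
        · intro h; exact absurd (mem_comps.mpr ⟨by rw [hs, hj], hpos⟩) h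
      · refine Finset.sum_eq_zero fun l hl => ?_
        rw [if_neg, mul_zero, zero_mul]
        rintro rfl
        exact hj ((mem_comps.mp hl).1.symm.trans hs)
    have L : ∀ j, ∑ l ∈ comps j, (N:ℚ)^j * (1 * zl e0 e1 l * pp (K+2)) i (wnil _) *
        Qd (N+1) l 1 = if j = K + 2 then (N:ℚ)^(K+2) * Qd (N+1) κ 1 else 0 := by
      intro j
      rw [← sumδ]
      refine Finset.sum_congr rfl fun l hl => ?_
      rw [one_mul, hZ l (mem_comps.mp hl).2]
    have Rr : ∀ j, K + 1 ≤ j → ∑ l ∈ comps j, (N:ℚ)^j * (G * zl f e1 l * pp (K+2)) i (wnil _) *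
        Qd N l 1 = if j = K + 2 then (N:ℚ)^(K+2) * Qd N κ 1 else 0 := by
      intro j hj
      rw [← sumδ]
      refine Finset.sum_congr rfl fun l hl => ?_
      have hl := mem_comps.mp hl
      rw [hmain l hl.2 (by omega), hZ l hl.2]
    rw [Finset.sum_congr rfl fun j _ => L j, Finset.sum_ite_eq' , if_pos (by simp),
      Finset.sum_range_succ, Finset.sum_range_succ, Rr (K+2) (by omega), Rr (K+1) (by omega),
      if_pos rfl, if_neg (by omega), add_zero] at hm3
    rw [hm3, add_comm]
    congr 1
    refine Finset.sum_congr rfl fun j _ => Finset.sum_congr rfl fun l _ => ?_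
    rw [hCe]

end mat

/-! ### Part 6: existence -/

theorem Qd_cons_two (N k : ℕ) (hk : 2 ≤ k) (l : List ℕ) (m : ℕ) :
    Qd N (k :: l) m = ∑ n ∈ Finset.Ico m N, (1/(n:ℚ)^k) * Qd N l (n+1) := by
  rw [Qd]
  refine Finset.sum_congr rfl fun n _ => ?_
  rw [if_neg (by omega), add_zero]

theorem Qd_snoc (N i : ℕ) (hi : 2 ≤ i) (l : List ℕ) (hl : ∀ x ∈ l, 2 ≤ x) :
    ∀ m, m ≤ N → Qd (N+1) (l ++ [i]) m = Qd N (l ++ [i]) m + 1/(N:ℚ)^i * Qd N l m := by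
  induction l with
  | nil =>
    intro m hm
    rw [List.nil_append, Qd_cons_two _ _ hi, Qd_cons_two _ _ hi, Finset.sum_Ico_succ_top hm]
    simp [Qd]
  | cons k l ih =>
    intro m hm
    have hk := hl k (by simp)
    have ih := ih (fun x hx => hl x (by simp [hx]))
    rw [List.cons_append, Qd_cons_two _ _ hk, Qd_cons_two _ _ hk, Qd_cons_two _ _ hk,
      Finset.sum_Ico_succ_top hm]
    have h0 : Qd (N+1) (l ++ [i]) (N+1) = 0 := by
      cases l with
      | nil => exact Qd_top _ _ _
      | cons a l => exact Qd_top _ _ _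
    rw [h0, mul_zero, add_zero, Finset.mul_sum, ← Finset.sum_add_distrib]
    refine Finset.sum_congr rfl fun n hn => ?_
    rw [Finset.mem_Ico] at hn
    rw [ih (n+1) (by omega)]
    ring

noncomputable def comps2 (j : ℕ) : Finset (List ℕ) := (comps j).filter fun l => ∀ x ∈ l, 2 ≤ x

theorem mem_comps2 {j : ℕ} {l : List ℕ} : l ∈ comps2 j ↔ l.sum = j ∧ ∀ x ∈ l, 2 ≤ x := by
  unfold comps2
  rw [Finset.mem_filter, mem_comps]
  constructor
  · rintro ⟨⟨h1, _⟩, h2⟩; exact ⟨h1, h2⟩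
  · rintro ⟨h1, h2⟩
    exact ⟨⟨h1, fun x hx => by have := h2 x hx; omega⟩, h2⟩

theorem comps2_zero : comps2 0 = {[]} := by
  unfold comps2
  rw [comps_zero]
  ext l
  simp only [Finset.mem_filter, Finset.mem_singleton]
  constructor
  · exact fun h => h.1
  · rintro rfl; simp

theorem sum_comps2_snoc (K : ℕ) (f : List ℕ → ℚ) :
    ∑ L ∈ comps2 (K+2), f L =
      ∑ j ∈ Finset.range (K+1), ∑ l ∈ comps2 j, f (l ++ [K+2-j]) := by
  rw [Finset.sum_sigma']
  symm
  refine Finset.sum_bij (fun x _ => x.2 ++ [K+2-x.1]) ?_ ?_ ?_ ?_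
  · rintro ⟨j, l⟩ h
    simp only [Finset.mem_sigma, Finset.mem_range, mem_comps2] at h ⊢
    obtain ⟨h1, h2, h3⟩ := h
    refine ⟨by simp only [List.sum_append, List.sum_singleton]; omega, ?_⟩
    intro x hx
    rcases List.mem_append.mp hx with hx | hx
    · exact h3 x hx
    · rw [List.mem_singleton] at hx; omega
  · rintro ⟨j, l⟩ h ⟨j', l'⟩ h' he
    simp only [Finset.mem_sigma, Finset.mem_range, mem_comps2] at h h'
    have he := List.append_inj' he rfl
    obtain ⟨h1, h2, h3⟩ := h
    obtain ⟨h1', h2', h3'⟩ := h'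
    obtain ⟨e1, e2⟩ := he
    dsimp only at e1 h2 h2'
    subst e1
    subst h2
    subst h2'
    rfl
  · intro L hL
    rw [mem_comps2] at hL
    rcases List.eq_nil_or_concat L with rfl | ⟨l, i, rfl⟩
    · simp at hL
    · rw [List.concat_eq_append] at hL ⊢
      have hi := hL.2 i (by simp)
      have hs := hL.1
      simp only [List.sum_append, List.sum_singleton] at hs
      refine ⟨⟨l.sum, l⟩, ?_, ?_⟩
      · simp only [Finset.mem_sigma, Finset.mem_range, mem_comps2]
        exact ⟨by omega, trivial, fun x hx => hL.2 x (by simp [hx])⟩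
      · have : K + 2 - l.sum = i := by omega
        rw [this]
  · intros; rfl

theorem Qd_one (l : List ℕ) (hl : l ≠ []) : Qd 1 l 1 = 0 := by
  cases l with
  | nil => exact absurd rfl hl
  | cons a l => exact Qd_top _ _ _

theorem exist_comb : ∀ (K : ℕ) (κ : List ℕ), (∀ x ∈ κ, 0 < x) → κ.sum = K →
    (κ = [] ∨ ∃ l0 m, κ = l0 ++ [m] ∧ 2 ≤ m) →
    ∃ d : List ℕ → ℤ, ∀ N : ℕ, 0 < N → Qd N κ 1 = ∑ l ∈ comps2 K, (d l : ℚ) * Qd N l 1 := by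
  intro K
  induction K using Nat.strong_induction_on with
  | _ K IH =>
  intro κ hpos hs hκ
  rcases hκ with rfl | hlast
  · refine ⟨fun _ => 1, fun N _ => ?_⟩
    simp only [List.sum_nil] at hs
    subst hs
    rw [comps2_zero]; simp
  · have hK2 : 2 ≤ K := by
      obtain ⟨l0, m, rfl, hm⟩ := hlast
      simp at hs; omega
    have hκne : κ ≠ [] := by
      rintro rfl
      simp at hs; omega
    obtain ⟨K, rfl⟩ : ∃ K', K = K' + 2 := ⟨K - 2, by omega⟩
    obtain ⟨c, hc1, hc⟩ := recN K κ hpos hs hlast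
    have hd : ∀ l : List ℕ, ∃ d : List ℕ → ℤ, (∀ x ∈ l, 0 < x) → l.sum ≤ K →
        ∀ N : ℕ, 0 < N → (c l : ℚ) * Qd N l 1 = ∑ l' ∈ comps2 l.sum, (d l' : ℚ) * Qd N l' 1 := by
      intro l
      by_cases hl : (∀ x ∈ l, 0 < x) ∧ l.sum ≤ K
      · by_cases hl1 : ∃ l0, l = l0 ++ [1]
        · refine ⟨fun _ => 0, fun _ _ N _ => ?_⟩
          obtain ⟨l0, rfl⟩ := hl1
          rw [hc1]; simp
        · obtain ⟨d, hd⟩ := IH l.sum (by omega) l hl.1 rfl (by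
            rcases List.eq_nil_or_concat l with rfl | ⟨l0, i, rfl⟩
            · exact Or.inl rfl
            · rw [List.concat_eq_append] at hl hl1 ⊢
              refine Or.inr ⟨l0, i, rfl, ?_⟩
              have := hl.1 i (by simp)
              have : i ≠ 1 := by
                rintro rfl
                exact hl1 ⟨l0, rfl⟩
              omega)
          refine ⟨fun l' => c l * d l', fun _ _ N hN => ?_⟩
          rw [hd N hN, Finset.mul_sum]
          refine Finset.sum_congr rfl fun l' _ => ?_
          push_cast; ring
      · exact ⟨fun _ => 0, fun h1 h2 => absurd ⟨h1, h2⟩ hl⟩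
    choose d hd using hd
    have hD : ∀ j, j ≤ K → ∀ N : ℕ, 0 < N →
        ∑ l ∈ comps j, (c l : ℚ) * Qd N l 1 =
          ∑ l' ∈ comps2 j, ((∑ l ∈ comps j, d l l' : ℤ) : ℚ) * Qd N l' 1 := by
      intro j hj N hN
      push_cast
      simp only [Finset.sum_mul]
      rw [Finset.sum_comm]
      refine Finset.sum_congr rfl fun l hl => ?_
      rw [mem_comps] at hl
      rw [hd l hl.2 (by omega) N hN, hl.1]
    refine ⟨fun L => ∑ l ∈ comps L.dropLast.sum, d l L.dropLast, fun N hN => ?_⟩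
    induction N, hN using Nat.le_induction with
    | base =>
      rw [Qd_one κ hκne]
      symm
      refine Finset.sum_eq_zero fun L hL => ?_
      rw [Qd_one, mul_zero]
      rintro rfl
      simp [mem_comps2] at hL
    | succ N hN ih =>
      have hN0 : 0 < N := hN
      have hNq : (N:ℚ) ≠ 0 := by positivity
      have h := hc N hN0
      have hNK : (N:ℚ)^(K+2) ≠ 0 := pow_ne_zero _ hNq
      apply mul_left_cancel₀ hNK
      rw [h, ih, sum_comps2_snoc, sum_comps2_snoc, Finset.mul_sum, Finset.mul_sum,
        ← Finset.sum_add_distrib]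
      refine Finset.sum_congr rfl fun j hj => ?_
      rw [Finset.mem_range] at hj
      simp only [mul_assoc]
      rw [← Finset.mul_sum, hD j (by omega) N hN0, Finset.mul_sum, Finset.mul_sum, Finset.mul_sum,
        ← Finset.sum_add_distrib]
      refine Finset.sum_congr rfl fun l hl => ?_
      rw [mem_comps2] at hl
      rw [Qd_snoc N (K+2-j) (by omega) l hl.2 1 hN]
      simp only [List.dropLast_concat, hl.1]
      have e : (N:ℚ)^(K+2) * (1/(N:ℚ)^(K+2-j)) = (N:ℚ)^j := by
        have : (N:ℚ)^(K+2) = (N:ℚ)^j * (N:ℚ)^(K+2-j) := by rw [← pow_add]; congr 1; omega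
        rw [this]; field_simp
      rw [← e]
      ring

/-! ### Part 7: uniqueness -/

section uniq
open Polynomial

theorem poly_zero_of_nat (P : ℚ[X]) (n0 : ℕ) (h : ∀ N : ℕ, n0 ≤ N → P.eval (N:ℚ) = 0) : P = 0 := by
  refine Polynomial.eq_zero_of_infinite_isRoot P ?_
  refine Set.infinite_of_injective_forall_mem (f := fun N : ℕ => ((N + n0 : ℕ) : ℚ)) ?_ ?_
  · intro a b hab
    dsimp only at hab
    have : a + n0 = b + n0 := by exact_mod_cast hab
    omega
  · intro N
    exact h _ (by omega)

theorem poly_zero_of_neg (P : ℚ[X]) (h : ∀ N : ℕ, P.eval (-(N:ℚ)) = 0) : P = 0 := by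
  refine Polynomial.eq_zero_of_infinite_isRoot P ?_
  refine Set.infinite_of_injective_forall_mem (f := fun N : ℕ => (-(N:ℚ))) ?_ ?_
  · intro a b hab
    simpa using hab
  · intro N
    exact h _

theorem poly_eventually_ne (q : ℚ[X]) (hq : q ≠ 0) : ∃ n0 : ℕ, ∀ N : ℕ, n0 ≤ N → q.eval (N:ℚ) ≠ 0 := by
  have hfin : Set.Finite {N : ℕ | q.eval (N:ℚ) = 0} := by
    have : Set.Finite {x : ℚ | q.IsRoot x} := Polynomial.finite_setOfPred_isRoot hq
    exact this.preimage (Nat.cast_injective.injOn)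
  obtain ⟨b, hb⟩ := hfin.bddAbove
  refine ⟨b+1, fun N hN h => ?_⟩
  have := hb h
  omega

theorem lemA (q P : ℚ[X]) (hq : q ≠ 0) (h : q * P.comp (X+1) = q.comp (X+1) * P) :
    ∃ c : ℚ, P = C c * q := by
  obtain ⟨n0, hn0⟩ := poly_eventually_ne q hq
  refine ⟨P.eval (n0:ℚ) / q.eval (n0:ℚ), ?_⟩
  rw [← sub_eq_zero]
  refine poly_zero_of_nat _ n0 fun N hN => ?_
  induction N, hN using Nat.le_induction with
  | base =>
    have := hn0 n0 le_rfl
    simp; field_simp; ring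
  | succ N hN ih =>
    have h1 := hn0 N hN
    have h' := congrArg (Polynomial.eval (N:ℚ)) h
    simp only [eval_mul, eval_comp, eval_add, eval_X, eval_one] at h'
    simp only [eval_sub, eval_mul, eval_C] at ih ⊢
    push_cast
    generalize eval (n0:ℚ) P / eval (n0:ℚ) q = c at *
    have e : P.eval (N:ℚ) = c * q.eval (N:ℚ) := by linarith
    rw [e] at h'
    apply mul_left_cancel₀ h1
    linear_combination h'

theorem lemB (q A s : ℚ[X]) (hq : q ≠ 0) (j : ℕ) (hj : 0 < j) (hs : s.eval 0 ≠ 0)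
    (h : X^j * (q * A.comp (X+1) - q.comp (X+1) * A) + s * q * q.comp (X+1) = 0) : False := by
  obtain ⟨d, a, b, hA, hb, hco⟩ : ∃ d a b : ℚ[X], A = d * a ∧ q = d * b ∧ IsCoprime a b := by
    have hd : EuclideanDomain.gcd A q ≠ 0 := fun h0 => hq (EuclideanDomain.gcd_eq_zero_iff.mp h0).2
    obtain ⟨a, ha⟩ := EuclideanDomain.gcd_dvd_left A q
    obtain ⟨b, hb⟩ := EuclideanDomain.gcd_dvd_right A q
    have hbez := EuclideanDomain.gcd_eq_gcd_ab A q
    generalize EuclideanDomain.gcd A q = d at *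
    generalize EuclideanDomain.gcdA A q = u at *
    generalize EuclideanDomain.gcdB A q = v at *
    refine ⟨d, a, b, ha, hb, u, v, ?_⟩
    apply mul_left_cancel₀ hd
    rw [mul_one]
    rw [ha, hb] at hbez
    linear_combination -hbez
  have hd0 : d ≠ 0 := by rintro rfl; simp at hb; exact hq hb
  have hb0 : b ≠ 0 := by rintro rfl; simp at hb; exact hq hb
  have hd1 : d.comp (X+1) ≠ 0 := by
    intro h0
    apply hd0
    refine poly_zero_of_nat d 1 fun N hN => ?_
    obtain ⟨M, rfl⟩ : ∃ M, N = M + 1 := ⟨N - 1, by omega⟩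
    have := congrArg (Polynomial.eval (M:ℚ)) h0
    simpa using this
  have h2 : X^j * (b * a.comp (X+1) - b.comp (X+1) * a) + s * b * b.comp (X+1) = 0 := by
    apply mul_left_cancel₀ (mul_ne_zero hd0 hd1)
    rw [hA, hb, mul_comp, mul_comp] at h
    rw [mul_zero, ← h]
    ring
  have hev : ∀ x : ℚ, x^j * (b.eval x * a.eval (x+1) - b.eval (x+1) * a.eval x) +
      s.eval x * b.eval x * b.eval (x+1) = 0 := by
    intro x
    have := congrArg (Polynomial.eval x) h2
    simpa using this
  have hne : ∀ x : ℚ, b.eval x = 0 → a.eval x ≠ 0 := by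
    intro x hx hax
    obtain ⟨u, v, huv⟩ := hco
    have := congrArg (Polynomial.eval x) huv
    simp [hx, hax] at this
  have hup : ∀ x : ℚ, x ≠ 0 → b.eval x = 0 → b.eval (x+1) = 0 := by
    intro x hx hbx
    have h3 := hev x
    rw [hbx] at h3
    have h4 : x^j * (b.eval (x+1) * a.eval x) = 0 := by linarith
    rcases mul_eq_zero.mp h4 with h5 | h5
    · exact absurd h5 (pow_ne_zero _ hx)
    · exact (mul_eq_zero.mp h5).resolve_right (hne x hbx)
  have hdown : ∀ x : ℚ, x ≠ 0 → b.eval (x+1) = 0 → b.eval x = 0 := by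
    intro x hx hbx
    have h3 := hev x
    rw [hbx] at h3
    have h4 : x^j * (b.eval x * a.eval (x+1)) = 0 := by linarith
    rcases mul_eq_zero.mp h4 with h5 | h5
    · exact absurd h5 (pow_ne_zero _ hx)
    · exact (mul_eq_zero.mp h5).resolve_right (hne _ hbx)
  have h00 := hev 0
  rw [zero_pow (by omega), zero_mul, zero_add, zero_add] at h00
  rcases mul_eq_zero.mp h00 with h3 | h3
  · have h3 := (mul_eq_zero.mp h3).resolve_left hs
    apply hb0
    refine poly_zero_of_neg b fun N => ?_
    induction N with
    | zero => simpa using h3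
    | succ N ih =>
      refine hdown _ ?_ ?_
      · have : (0:ℚ) < ((N+1:ℕ):ℚ) := by positivity
        linarith
      · have : -((N+1:ℕ):ℚ) + 1 = -(N:ℚ) := by push_cast; ring
        rw [this]; exact ih
  · apply hb0
    refine poly_zero_of_nat b 1 fun N hN => ?_
    induction N, hN using Nat.le_induction with
    | base => simpa using h3
    | succ N hN ih =>
      push_cast
      exact hup _ (by positivity) ih

theorem uniq_main : ∀ (n : ℕ) (T : Finset (List ℕ)), T.card = n →
    (∀ l i, l ++ [i] ∈ T → l ∈ T) → (∀ l ∈ T, ∀ x ∈ l, 2 ≤ x) → ∀ P : List ℕ → ℚ[X],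
    (∀ N : ℕ, 0 < N → ∑ l ∈ T, (P l).eval (N:ℚ) * Qd N l 1 = 0) → ∀ l ∈ T, P l = 0 := by
  intro n
  induction n with
  | zero =>
    intro T hT _ _ P _ l hl
    rw [Finset.card_eq_zero] at hT
    subst hT
    simp at hl
  | succ n IH =>
    intro T hT hpre h2 P hP
    have hne : T.Nonempty := by rw [← Finset.card_pos]; omega
    obtain ⟨lm, hlm, hlmax⟩ := Finset.exists_max_image T List.length hne
    rcases List.eq_nil_or_concat lm with rfl | ⟨p, j1, rfl⟩
    · -- only the empty list
      have hall : ∀ l ∈ T, l = [] := by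
        intro l hl
        have := hlmax l hl
        simpa using this
      have hTe : T = {[]} := by
        ext l
        rw [Finset.mem_singleton]
        exact ⟨hall l, fun h => by rw [h]; exact hlm⟩
      subst hTe
      intro l hl
      rw [hall l hl]
      refine poly_zero_of_nat _ 1 fun N hN => ?_
      have := hP N hN
      simpa [Qd] using this
    · rw [List.concat_eq_append] at hlm hlmax
      obtain ⟨l0, hl0, hl0max⟩ := Finset.exists_max_image
        (T.filter fun x => x ≠ [] ∧ x.dropLast = p) (fun x => x.getLast?.getD 0)
        ⟨p ++ [j1], by simp [hlm]⟩
      rw [Finset.mem_filter] at hl0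
      obtain ⟨hl0T, hl0ne, hl0p⟩ := hl0
      obtain ⟨j0, rfl⟩ : ∃ j0, l0 = p ++ [j0] := by
        rcases List.eq_nil_or_concat l0 with h | ⟨p', j, rfl⟩
        · exact absurd h hl0ne
        · rw [List.concat_eq_append] at hl0p ⊢
          rw [List.dropLast_concat] at hl0p
          exact ⟨j, by rw [hl0p]⟩
      have hj0max : ∀ j, p ++ [j] ∈ T → j ≤ j0 := by
        intro j hj
        have := hl0max (p ++ [j]) (by simp [hj])
        simpa using this
      have hleaf : ∀ j i, p ++ [j] ++ [i] ∉ T := by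
        intro j i h
        have := hlmax _ h
        simp at this
      have hTe : (T.erase (p ++ [j0])).card = n := by
        rw [Finset.card_erase_of_mem hl0T]; omega
      have hpree : ∀ l i, l ++ [i] ∈ T.erase (p ++ [j0]) → l ∈ T.erase (p ++ [j0]) := by
        intro l i h
        rw [Finset.mem_erase] at h ⊢
        refine ⟨?_, hpre l i h.2⟩
        rintro rfl
        exact hleaf _ _ h.2
      have IH' : ∀ P' : List ℕ → ℚ[X], P' (p ++ [j0]) = 0 →
          (∀ N : ℕ, 0 < N → ∑ l ∈ T, (P' l).eval (N:ℚ) * Qd N l 1 = 0) → ∀ l ∈ T, P' l = 0 := by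
        intro P' h0 hP' l hl
        by_cases hll : l = p ++ [j0]
        · rw [hll, h0]
        · refine IH _ hTe hpree (fun l hl => h2 l (Finset.mem_of_mem_erase hl)) P' ?_ l
            (Finset.mem_erase.mpr ⟨hll, hl⟩)
          intro N hN
          rw [← hP' N hN, ← Finset.add_sum_erase _ _ hl0T, h0]
          simp
      by_cases hq : P (p ++ [j0]) = 0
      · exact IH' P hq hP
      · exfalso
        obtain ⟨q, hqe⟩ : ∃ q, q = P (p ++ [j0]) := ⟨_, rfl⟩
        rw [← hqe] at hq
        obtain ⟨J, hJ⟩ : ∃ J, J = T.sup (fun l => l.getLast?.getD 0) := ⟨_, rfl⟩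
        have hJle : ∀ L ∈ T, L.getLast?.getD 0 ≤ J := by
          intro L hL
          rw [hJ]
          exact Finset.le_sup (f := fun l : List ℕ => l.getLast?.getD 0) hL
        obtain ⟨ch, hch⟩ : ∃ ch : List ℕ → Finset (List ℕ),
          ch = fun l => (T.filter fun x => x ≠ []).filter fun x => x.dropLast = l := ⟨_, rfl⟩
        have mem_ch : ∀ l L, L ∈ ch l ↔ ∃ j, L = l ++ [j] ∧ L ∈ T := by
          intro l L
          rw [hch]
          simp only [Finset.mem_filter]
          constructor
          · rintro ⟨⟨h1, h3⟩, h4⟩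
            rcases List.eq_nil_or_concat L with h | ⟨p', j, rfl⟩
            · exact absurd h h3
            · rw [List.concat_eq_append] at *
              rw [List.dropLast_concat] at h4
              exact ⟨j, by rw [h4], h1⟩
          · rintro ⟨j, rfl, h⟩
            exact ⟨⟨h, by simp⟩, by simp⟩
        obtain ⟨P', hP'⟩ : ∃ P' : List ℕ → ℚ[X], P' = fun l =>
          X^J * (q * (P l).comp (X+1) - q.comp (X+1) * P l) +
            ∑ L ∈ ch l, X^(J - L.getLast?.getD 0) * q * (P L).comp (X+1) := ⟨_, rfl⟩
        have hch0 : ∀ j, ch (p ++ [j]) = ∅ := by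
          intro j
          rw [Finset.eq_empty_iff_forall_notMem]
          intro L hL
          obtain ⟨i, rfl, h⟩ := (mem_ch _ _).mp hL
          exact hleaf _ _ h
        have hall := IH' P' (by
          rw [hP']
          simp only [hch0, Finset.sum_empty, add_zero, ← hqe]
          ring) (by
          intro N hN
          have hNq : (N:ℚ) ≠ 0 := by positivity
          have r0 := hP N hN
          have r1 := hP (N+1) (by omega)
          have hsplit : ∑ l ∈ T, (P l).eval ((N+1:ℕ):ℚ) * Qd (N+1) l 1 =
              ∑ l ∈ T, (P l).eval ((N:ℚ)+1) * Qd N l 1 +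
              ∑ L ∈ T.filter (fun x => x ≠ []),
                (P L).eval ((N:ℚ)+1) * (1/(N:ℚ)^(L.getLast?.getD 0) * Qd N L.dropLast 1) := by
            rw [Finset.sum_filter, ← Finset.sum_add_distrib]
            refine Finset.sum_congr rfl fun L hL => ?_
            rcases List.eq_nil_or_concat L with rfl | ⟨p', j, rfl⟩
            · simp [Qd]
            · rw [List.concat_eq_append] at *
              rw [if_pos (by simp), Qd_snoc N j (h2 _ hL j (by simp)) p'
                (fun x hx => h2 _ hL x (by simp [hx])) 1 hN]
              simp only [List.dropLast_concat, List.getLast?_concat, Option.getD_some]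
              push_cast; ring
          have hfib := Finset.sum_fiberwise_of_maps_to (s := T.filter (fun x => x ≠ [])) (t := T)
            (g := List.dropLast) (by
              intro L hL
              rw [Finset.mem_filter] at hL
              rcases List.eq_nil_or_concat L with h | ⟨p', j, rfl⟩
              · exact absurd h hL.2
              · rw [List.concat_eq_append] at *
                rw [List.dropLast_concat]
                exact hpre _ _ hL.1)
            (fun L => (P L).eval ((N:ℚ)+1) * (1/(N:ℚ)^(L.getLast?.getD 0) * Qd N L.dropLast 1))
          rw [hsplit, ← hfib] at r1
          have key : ∑ l ∈ T, (P' l).eval (N:ℚ) * Qd N l 1 =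
              (N:ℚ)^J * (q.eval (N:ℚ) * (∑ l ∈ T, (P l).eval ((N:ℚ)+1) * Qd N l 1 +
                ∑ l ∈ T, ∑ L ∈ (T.filter fun x => x ≠ []).filter fun x => x.dropLast = l,
                  (P L).eval ((N:ℚ)+1) * (1/(N:ℚ)^(L.getLast?.getD 0) * Qd N L.dropLast 1))
                - q.eval ((N:ℚ)+1) * ∑ l ∈ T, (P l).eval (N:ℚ) * Qd N l 1) := by
            rw [← Finset.sum_add_distrib, Finset.mul_sum, Finset.mul_sum,
              ← Finset.sum_sub_distrib, Finset.mul_sum]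
            refine Finset.sum_congr rfl fun l hl => ?_
            rw [hP']
            have hchl : ((T.filter fun x => x ≠ []).filter fun x => x.dropLast = l) = ch l := by
              rw [hch]
            rw [hchl]
            simp only [eval_add, eval_mul, eval_sub, eval_pow, eval_X, eval_comp, eval_one,
              eval_finsetSum]
            have e : (∑ L ∈ ch l, (N:ℚ)^(J - L.getLast?.getD 0) * q.eval (N:ℚ) *
                (P L).eval ((N:ℚ)+1)) * Qd N l 1 = (N:ℚ)^J * (q.eval (N:ℚ) * ∑ L ∈ ch l,
                (P L).eval ((N:ℚ)+1) * (1/(N:ℚ)^(L.getLast?.getD 0) * Qd N L.dropLast 1)) := by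
              rw [Finset.sum_mul, Finset.mul_sum, Finset.mul_sum]
              refine Finset.sum_congr rfl fun L hL => ?_
              obtain ⟨j, rfl, hLT⟩ := (mem_ch _ _).mp hL
              have hle := hJle _ hLT
              simp only [List.dropLast_concat, List.getLast?_concat, Option.getD_some] at hle ⊢
              have : (N:ℚ)^J = (N:ℚ)^(J-j) * (N:ℚ)^j := by
                rw [← pow_add]; congr 1; omega
              rw [this]
              field_simp
            rw [add_mul, e]
            ring
          rw [key, r1, r0, mul_zero, mul_zero, sub_zero, mul_zero])
        -- siblings
        have hXJ : ∀ i : ℕ, (X:ℚ[X])^i ≠ 0 := fun i => pow_ne_zero _ X_ne_zero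
        have hsib : ∀ L, ∃ c : ℚ, L ∈ ch p → P L = C c * q := by
          intro L
          by_cases hL : L ∈ ch p
          · obtain ⟨j, rfl, hLT⟩ := (mem_ch _ _).mp hL
            have h := hall _ hLT
            rw [hP'] at h
            simp only [hch0, Finset.sum_empty, add_zero] at h
            have h := (mul_eq_zero.mp h).resolve_left (hXJ J)
            obtain ⟨c, hc⟩ := lemA q _ hq (sub_eq_zero.mp h)
            exact ⟨c, fun _ => hc⟩
          · exact ⟨0, fun h => absurd h hL⟩
        choose c hc using hsib
        have hl0ch : p ++ [j0] ∈ ch p := (mem_ch _ _).mpr ⟨j0, rfl, hl0T⟩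
        have hc0 : c (p ++ [j0]) = 1 := by
          have h := hc _ hl0ch
          rw [← hqe] at h
          have h3 : (C (c (p ++ [j0])) - 1) * q = 0 := by rw [sub_mul, ← h, one_mul, sub_self]
          have h4 := (mul_eq_zero.mp h3).resolve_right hq
          have h5 := congrArg (Polynomial.eval 0) h4
          simp at h5
          linarith
        have hpT : p ∈ T := hpre _ _ hl0T
        have hj02 : 2 ≤ j0 := h2 _ hl0T j0 (by simp)
        have hj0J : j0 ≤ J := by
          have := hJle _ hl0T
          simpa using this
        have hpp := hall p hpT
        rw [hP'] at hpp
        dsimp only at hpp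
        obtain ⟨s, hs⟩ : ∃ s : ℚ[X], s = ∑ L ∈ ch p, C (c L) * X^(j0 - L.getLast?.getD 0) := ⟨_, rfl⟩
        refine lemB q (P p) s hq j0 (by omega) ?_ ?_
        · rw [hs, eval_finsetSum, Finset.sum_eq_single (p ++ [j0])]
          · simp [hc0]
          · intro L hL hLne
            obtain ⟨j, rfl, hLT⟩ := (mem_ch _ _).mp hL
            have h3 := hj0max j hLT
            have h4 : j ≠ j0 := by rintro rfl; exact hLne rfl
            have h5 : j0 - j ≠ 0 := by omega
            simp [h5]
          · intro h; exact absurd hl0ch h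
        · apply mul_left_cancel₀ (hXJ (J - j0))
          rw [mul_zero, ← hpp, mul_add, ← mul_assoc, ← pow_add]
          congr 1
          · congr 2; omega
          · rw [hs, Finset.sum_mul, Finset.sum_mul, Finset.mul_sum]
            refine Finset.sum_congr rfl fun L hL => ?_
            rw [hc L hL]
            obtain ⟨j, rfl, hLT⟩ := (mem_ch _ _).mp hL
            have h3 := hj0max j hLT
            simp only [List.getLast?_concat, Option.getD_some, mul_comp, C_comp]
            have : J - j = (J - j0) + (j0 - j) := by omega
            rw [this, pow_add]
            ring

end uniq

theorem sum_sub_comps2 (k : ℕ) (f : List ℕ → ℚ) :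
    ∑ l : {l : Composition k // ∀ x ∈ l.blocks, 2 ≤ x}, f l.1.blocks = ∑ l ∈ comps2 k, f l := by
  refine Finset.sum_bij (fun l _ => l.1.blocks) ?_ ?_ ?_ ?_
  · intro l _
    exact mem_comps2.mpr ⟨l.1.blocks_sum, l.2⟩
  · intro a _ b _ h
    exact Subtype.ext (Composition.ext h)
  · intro l hl
    rw [mem_comps2] at hl
    exact ⟨⟨⟨l, fun {x} hx => by have := hl.2 x hx; omega, hl.1⟩, hl.2⟩, Finset.mem_univ _, rfl⟩
  · intros; rfl

theorem uniq_comps2 (k : ℕ) (a : List ℕ → ℚ)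
    (h : ∀ N : ℕ, 0 < N → ∑ l ∈ comps2 k, a l * Qd N l 1 = 0) : ∀ l ∈ comps2 k, a l = 0 := by
  intro l hl
  obtain ⟨T, hT⟩ : ∃ T, T = (Finset.range (k+1)).biUnion comps2 := ⟨_, rfl⟩
  have memT : ∀ l, l ∈ T ↔ l.sum ≤ k ∧ ∀ x ∈ l, 2 ≤ x := by
    intro l
    rw [hT, Finset.mem_biUnion]
    constructor
    · rintro ⟨j, hj, hl⟩
      rw [mem_comps2] at hl
      rw [Finset.mem_range] at hj
      exact ⟨by omega, hl.2⟩
    · rintro ⟨h1, h2⟩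
      exact ⟨l.sum, Finset.mem_range.mpr (by omega), mem_comps2.mpr ⟨rfl, h2⟩⟩
  have hsub : comps2 k ⊆ T := by
    intro l hl
    rw [mem_comps2] at hl
    exact (memT l).mpr ⟨hl.1.le, hl.2⟩
  have := uniq_main T.card T rfl
    (by
      intro l i h
      rw [memT] at h ⊢
      have h1 := h.1
      simp only [List.sum_append, List.sum_singleton] at h1
      exact ⟨by omega, fun x hx => h.2 x (by simp [hx])⟩)
    (fun l hl => ((memT l).mp hl).2)
    (fun l => if l ∈ comps2 k then Polynomial.C (a l) else 0)
    (by
      intro N hN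
      rw [← h N hN, ← Finset.sum_subset hsub]
      · refine Finset.sum_congr rfl fun l hl => ?_
        rw [if_pos hl, Polynomial.eval_C]
      · intro l _ hl
        rw [if_neg hl]; simp) l (hsub hl)
  rw [if_pos hl] at this
  exact Polynomial.C_eq_zero.mp this

/-- **Theorem.**  Let `k ≥ 2` and let `κ` be an admissible index of weight `k`
(encoded as a `Composition k` whose last block is `≥ 2`).  There is a unique family
of integers `(c_l)`, indexed by the indices `l` of weight `k` with all entries `≥ 2`,
such that for every positive integer `N` one has
`ζ◇_N(κ) = ∑_l c_l · ζ_N(l)`. -/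
theorem zdia_unique_int_comb (k : ℕ) (hk : 2 ≤ k) (κ : Composition k)
    (hκ : ∃ m, κ.blocks.getLast? = some m ∧ 2 ≤ m) :
    ∃! c : {l : Composition k // ∀ x ∈ l.blocks, 2 ≤ x} → ℤ,
      ∀ N : ℕ, 0 < N →
        zdiaL N κ.blocks =
          ∑ l : {l : Composition k // ∀ x ∈ l.blocks, 2 ≤ x},
            (c l : ℚ) * mhsL N l.1.blocks := by
  have hκ' : κ.blocks = [] ∨ ∃ l0 m, κ.blocks = l0 ++ [m] ∧ 2 ≤ m := by
    right
    obtain ⟨m, hm, hm2⟩ := hκ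
    obtain ⟨l0, hl0⟩ := List.getLast?_eq_some_iff.mp hm
    exact ⟨l0, m, hl0, hm2⟩
  obtain ⟨d, hd⟩ := exist_comb k κ.blocks (fun x hx => κ.blocks_pos hx) κ.blocks_sum hκ'
  have hm : ∀ (N : ℕ) (l : {l : Composition k // ∀ x ∈ l.blocks, 2 ≤ x}),
      mhsL N l.1.blocks = Qd N l.1.blocks 1 := by
    intro N l
    rw [mhsL_eq_zdiaL N _ l.2, zdiaL_eq_Qd]
  refine ⟨fun l => d l.1.blocks, ?_, ?_⟩
  · intro N hN
    simp only [hm]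
    rw [zdiaL_eq_Qd, hd N hN, ← sum_sub_comps2 k (fun l => (d l : ℚ) * Qd N l 1)]
  · intro c hc
    obtain ⟨c', hc'⟩ : ∃ c' : List ℕ → ℤ,
        ∀ l : {l : Composition k // ∀ x ∈ l.blocks, 2 ≤ x}, c' l.1.blocks = c l := by
      refine ⟨fun L => if h : ∃ l : {l : Composition k // ∀ x ∈ l.blocks, 2 ≤ x},
        l.1.blocks = L then c h.choose else 0, fun l => ?_⟩
      have h : ∃ l' : {l : Composition k // ∀ x ∈ l.blocks, 2 ≤ x},
        l'.1.blocks = l.1.blocks := ⟨l, rfl⟩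
      dsimp only
      rw [dif_pos h]
      congr 1
      exact Subtype.ext (Composition.ext h.choose_spec)
    have hu := uniq_comps2 k (fun l => (c' l : ℚ) - d l) (by
      intro N hN
      have h1 := hc N hN
      simp only [hm, ← hc'] at h1
      rw [zdiaL_eq_Qd, hd N hN, sum_sub_comps2 k (fun l => (c' l : ℚ) * Qd N l 1)] at h1
      simp only [sub_mul]
      rw [Finset.sum_sub_distrib, h1, sub_self])
    funext l
    have h2 := hu l.1.blocks (mem_comps2.mpr ⟨l.1.blocks_sum, l.2⟩)
    have h3 : (c' l.1.blocks : ℚ) = d l.1.blocks := sub_eq_zero.mp h2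
    rw [← hc' l]
    exact_mod_cast h3
end

section
/- Let N be a positive integer, k=(k_1,…,k_r) and l=(k_{r+1},…,k_{r+s}) indices. For d ∈ {0,…,min(r,s)}, let Σ_{r,s,d} be the set of surjections σ: {1,…,r+s} → {1,…,r+s−d} satisfying σ(1)<⋯<σ(r) and σ(r+1)<⋯<σ(r+s), and for σ ∈ Σ_{r,s,d} define k^σ_j = k_a if σ^{−1}({j})={a}, and k^σ_j = k_a+k_b if σ^{−1}({j})={a,b} with a≠b. Then in the rational function field ℚ(t): F_N(k;t)·F_N(l;t) = Σ_{d=0}^{min(r,s)} (−1)^d Σ_{σ∈Σ_{r,s,d}} F_N(k^σ_1,…,k^σ_{r+s−d};t). -/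
open scoped Classical

/-- The Kawashima-like function `F_N(k;t) ∈ ℚ(t)` attached to an index
`k : Fin r → ℕ`:
`F_N(k;t) = ∑_{A⊂[r]} (-1)^{#A} ∑_{(n₁,…,n_r) ∈ S̄_{r,N}(A)}
  (∏_{i∈A} 1/(N-nᵢ+t)^{kᵢ}) (∏_{i∉A} 1/nᵢ^{kᵢ})`,
where `S̄_{r,N}(A)` consists of tuples in `{1,…,N-1}^r` with `nᵢ₋₁ ≤ nᵢ` when
`i ∉ A` and `nᵢ₋₁ < nᵢ` when `i ∈ A` (0-based: the comparison between positions
`i` and `i+1` is strict exactly when position `i+1` lies in `A`). -/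
noncomputable def FN (N : ℕ) {r : ℕ} (k : Fin r → ℕ) : RatFunc ℚ :=
  ∑ A : Finset (Fin r),
    (-1 : RatFunc ℚ) ^ A.card *
    ∑ n ∈ Finset.univ.filter (fun n : Fin r → Fin N =>
      (∀ i, 0 < (n i : ℕ)) ∧
      ∀ (i : Fin r) (h : (i : ℕ) + 1 < r),
        if (⟨(i : ℕ) + 1, h⟩ : Fin r) ∈ A then n i < n ⟨(i : ℕ) + 1, h⟩
        else n i ≤ n ⟨(i : ℕ) + 1, h⟩),
      ∏ i : Fin r,
        if i ∈ A then
          1 / ((N : RatFunc ℚ) - ((n i : ℕ) : RatFunc ℚ) + RatFunc.X) ^ k i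
        else 1 / (((n i : ℕ) : RatFunc ℚ)) ^ k i

namespace HP

/-- Signed quasi-shuffle product, paired with a functional. -/
noncomputable def Q {R : Type*} [CommRing R] : List ℕ → List ℕ → (List ℕ → R) → R
  | [], l, φ => φ l
  | a :: k, [], φ => φ (a :: k)
  | a :: k, b :: l, φ =>
      Q k (b :: l) (fun w => φ (a :: w)) + Q (a :: k) l (fun w => φ (b :: w))
        - Q k l (fun w => φ ((a + b) :: w))
termination_by k l => k.length + l.length

lemma Q_nil_left {R : Type*} [CommRing R] (l : List ℕ) (φ : List ℕ → R) : Q [] l φ = φ l := by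
  rw [Q]

lemma Q_nil_right {R : Type*} [CommRing R] (k : List ℕ) (φ : List ℕ → R) : Q k [] φ = φ k := by
  cases k <;> rw [Q]

lemma Q_cons {R : Type*} [CommRing R] (a b : ℕ) (k l : List ℕ) (φ : List ℕ → R) :
    Q (a :: k) (b :: l) φ =
      Q k (b :: l) (fun w => φ (a :: w)) + Q (a :: k) l (fun w => φ (b :: w))
        - Q k l (fun w => φ ((a + b) :: w)) := by
  rw [Q]

lemma Q_lin {R : Type*} [CommRing R] (n : ℕ) : ∀ (k l : List ℕ), k.length + l.length ≤ n →
    ∀ (c : R) (φ ψ : List ℕ → R),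
    Q k l (fun w => φ w + c * ψ w) = Q k l φ + c * Q k l ψ := by
  induction n with
  | zero =>
    intro k l h c φ ψ
    have : k = [] := List.length_eq_zero_iff.mp (by omega)
    subst this
    simp [Q_nil_left]
  | succ n ih =>
    intro k l h c φ ψ
    cases k with
    | nil => simp [Q_nil_left]
    | cons a k =>
      cases l with
      | nil => simp [Q_nil_right]
      | cons b l =>
        simp only [List.length_cons] at h
        rw [Q_cons, Q_cons, Q_cons,
          ih k (b :: l) (by simp only [List.length_cons]; omega) c
            (fun w => φ (a :: w)) (fun w => ψ (a :: w)),
          ih (a :: k) l (by simp only [List.length_cons]; omega) c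
            (fun w => φ (b :: w)) (fun w => ψ (b :: w)),
          ih k l (by omega) c
            (fun w => φ ((a + b) :: w)) (fun w => ψ ((a + b) :: w))]
        ring

/-- Multiplicativity with respect to the signed quasi-shuffle product. -/
def Mult {R : Type*} [CommRing R] (φ : List ℕ → R) : Prop :=
  φ [] = 1 ∧ ∀ k l, φ k * φ l = Q k l φ

lemma Mult.unbarred {R : Type*} [CommRing R] {φ ψ : List ℕ → R} (hφ : Mult φ) (x : ℕ → R)
    (hx : ∀ a b, x (a + b) = x a * x b) (h0 : ψ [] = 1)
    (h : ∀ a w, ψ (a :: w) = φ (a :: w) + x a * ψ w) : Mult ψ := by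
  refine ⟨h0, ?_⟩
  have key : ∀ (n : ℕ) (k l : List ℕ), k.length + l.length ≤ n → ψ k * ψ l = Q k l ψ := by
    intro n
    induction n with
    | zero =>
      intro k l hn
      have : k = [] := List.length_eq_zero_iff.mp (by omega)
      subst this
      simp [Q_nil_left, h0]
    | succ n ih =>
      intro k l hn
      cases k with
      | nil => simp [Q_nil_left, h0]
      | cons a k =>
        cases l with
        | nil => simp [Q_nil_right, h0]
        | cons b l =>
          simp only [List.length_cons] at hn
          have e := hφ.2 (a :: k) (b :: l)
          rw [Q_cons] at e
          rw [Q_cons]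
          simp only [h]
          rw [Q_lin _ k (b :: l) le_rfl (x a) (fun w => φ (a :: w)) ψ,
            Q_lin _ (a :: k) l le_rfl (x b) (fun w => φ (b :: w)) ψ,
            Q_lin _ k l le_rfl (x (a + b)) (fun w => φ ((a + b) :: w)) ψ,
            ← ih k (b :: l) (by simp only [List.length_cons]; omega),
            ← ih (a :: k) l (by simp only [List.length_cons]; omega),
            ← ih k l (by omega), h, h, hx]
          linear_combination e
  exact fun k l => key _ k l le_rfl

lemma Mult.barred {R : Type*} [CommRing R] {φ ψ : List ℕ → R} (hφ : Mult φ) (y : ℕ → R)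
    (hy : ∀ a b, y (a + b) = -(y a * y b)) (h0 : ψ [] = 1)
    (h : ∀ a w, ψ (a :: w) = φ (a :: w) + y a * φ w) : Mult ψ := by
  refine ⟨h0, ?_⟩
  intro k l
  cases k with
  | nil => simp [Q_nil_left, h0]
  | cons a k =>
    cases l with
    | nil => simp [Q_nil_right, h0]
    | cons b l =>
      have e := hφ.2 (a :: k) (b :: l)
      rw [Q_cons] at e
      rw [Q_cons]
      simp only [h]
      rw [Q_lin _ k (b :: l) le_rfl (y a) (fun w => φ (a :: w)) φ,
        Q_lin _ (a :: k) l le_rfl (y b) (fun w => φ (b :: w)) φ,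
        Q_lin _ k l le_rfl (y (a + b)) (fun w => φ ((a + b) :: w)) φ,
        ← hφ.2, ← hφ.2, ← hφ.2, hy]
      linear_combination e

/-- Order relation for the next letter. -/
def rel {N : ℕ} (m : ℕ) (c : Bool × Fin N) : Prop :=
  if c.1 then m < (c.2 : ℕ) else m ≤ (c.2 : ℕ)

/-- Sum over chains beginning above `m`. -/
noncomputable def U {R : Type*} [CommRing R] {N : ℕ} (W : Bool × Fin N → ℕ → R) :
    ℕ → List ℕ → R
  | _, [] => 1
  | m, a :: w => ∑ c : Bool × Fin N, if rel m c then W c a * U W (c.2 : ℕ) w else 0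

lemma U_cons {R : Type*} [CommRing R] {N : ℕ} (W : Bool × Fin N → ℕ → R) (m a : ℕ)
    (w : List ℕ) : U W m (a :: w) =
      ∑ n : Fin N, ((if m < (n : ℕ) then W (true, n) a * U W n w else 0)
        + (if m ≤ (n : ℕ) then W (false, n) a * U W n w else 0)) := by
  rw [U, Fintype.sum_prod_type, Fintype.sum_bool, Finset.sum_add_distrib]
  simp [rel]

lemma U_mult {R : Type*} [CommRing R] {N : ℕ} (W : Bool × Fin N → ℕ → R)
    (hx : ∀ n a b, W (false, n) (a + b) = W (false, n) a * W (false, n) b)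
    (hy : ∀ n a b, W (true, n) (a + b) = -(W (true, n) a * W (true, n) b)) (m : ℕ) :
    Mult (U W m) := by
  have top : ∀ m, N ≤ m → ∀ a w, U W m (a :: w) = 0 := by
    intro m hm a w
    rw [U_cons]
    apply Finset.sum_eq_zero
    intro n _
    have := n.2
    rw [if_neg (by omega), if_neg (by omega), add_zero]
  have key : ∀ j m, N ≤ m + j → Mult (U W m) := by
    intro j
    induction j with
    | zero =>
      intro m hm
      refine ⟨by rw [U], ?_⟩
      have hz : ∀ (k l : List ℕ) (φ : List ℕ → R), (∀ a w, φ (a :: w) = 0) →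
          k ≠ [] → Q k l φ = 0 := by
        intro k l φ hφ hk
        cases k with
        | nil => exact absurd rfl hk
        | cons a k =>
          have hz0 : ∀ (n : ℕ) (k l : List ℕ), k.length + l.length ≤ n →
              Q k l (fun _ => (0 : R)) = 0 := by
            intro n k l hn
            have := Q_lin n k l hn (-1 : R) (fun _ => 0) (fun _ => 0)
            simpa using this
          cases l with
          | nil => rw [Q_nil_right, hφ]
          | cons b l =>
            rw [Q_cons]
            simp only [hφ]
            rw [hz0 _ _ _ le_rfl, hz0 _ _ _ le_rfl, hz0 _ _ _ le_rfl]; simp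
      intro k l
      cases k with
      | nil => rw [Q_nil_left, U, one_mul]
      | cons a k =>
        rw [top m (by omega), hz _ _ _ (top m (by omega)) (by simp), zero_mul]
    | succ j ih =>
      intro m hm
      by_cases hmN : N ≤ m
      · exact ih m (by omega)
      have hm' : m < N := by omega
      have h1 := ih (m + 1) (by omega)
      -- barred letter m+1
      let y : ℕ → R := fun a => if h : m + 1 < N then W (true, ⟨m + 1, h⟩) a else 0
      let ψ : List ℕ → R := fun w => match w with
        | [] => 1
        | a :: w => U W (m + 1) (a :: w) + y a * U W (m + 1) w
      have h2 : Mult ψ := by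
        refine Mult.barred h1 y ?_ rfl (fun a w => rfl)
        intro a b
        by_cases h : m + 1 < N
        · simp only [y, dif_pos h, hy]
        · simp only [y, dif_neg h]; simp
      refine Mult.unbarred h2 (W (false, ⟨m, hm'⟩)) (hx _) (by rw [U]) ?_
      intro a w
      change _ = (U W (m + 1) (a :: w) + y a * U W (m + 1) w) + _
      rw [U_cons, U_cons]
      have e1 : y a * U W (m + 1) w =
          ∑ n : Fin N, if (n : ℕ) = m + 1 then W (true, n) a * U W n w else 0 := by
        by_cases h : m + 1 < N
        · rw [Finset.sum_eq_single ⟨m + 1, h⟩]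
          · simp [y, h]
          · intro b _ hb
            rw [if_neg]
            intro hh
            exact hb (Fin.ext hh)
          · simp
        · simp only [y, dif_neg h, zero_mul]
          symm
          apply Finset.sum_eq_zero
          intro n _
          have := n.2
          rw [if_neg (by omega)]
      have e2 : W (false, ⟨m, hm'⟩) a * U W m w =
          ∑ n : Fin N, if (n : ℕ) = m then W (false, n) a * U W n w else 0 := by
        rw [Finset.sum_eq_single ⟨m, hm'⟩]
        · simp
        · intro b _ hb
          rw [if_neg]
          intro hh
          exact hb (Fin.ext hh)
        · simp
      rw [e1, e2, ← Finset.sum_add_distrib, ← Finset.sum_add_distrib]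
      apply Finset.sum_congr rfl
      intro n _
      rcases lt_trichotomy (n : ℕ) m with h | h | h
      · simp [show ¬ m < (n : ℕ) by omega, show ¬ m ≤ (n : ℕ) by omega,
          show ¬ m + 1 < (n : ℕ) by omega, show ¬ m + 1 ≤ (n : ℕ) by omega,
          show ¬ (n : ℕ) = m + 1 by omega, show ¬ (n : ℕ) = m by omega]
      · simp [h]
      · by_cases h' : (n : ℕ) = m + 1
        · simp [h']; ring
        · simp [show m < (n : ℕ) by omega, show m ≤ (n : ℕ) by omega,
            show m + 1 < (n : ℕ) by omega, show m + 1 ≤ (n : ℕ) by omega,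
            show ¬ (n : ℕ) = m + 1 by omega, show ¬ (n : ℕ) = m by omega]
  exact key N m (by omega)

/-- Valid chains beginning above `m`. -/
def valid {N r : ℕ} (m : ℕ) (c : Fin r → Bool × Fin N) : Prop :=
  ∀ i : Fin r, rel (if h : (i : ℕ) = 0 then m else ((c ⟨i - 1, by omega⟩).2 : ℕ)) (c i)

lemma valid_cons {N r : ℕ} (m : ℕ) (x : Bool × Fin N) (c : Fin r → Bool × Fin N) :
    valid m (Fin.cons x c : Fin (r + 1) → Bool × Fin N) ↔ rel m x ∧ valid (x.2 : ℕ) c := by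
  unfold valid
  rw [Fin.forall_fin_succ]
  apply and_congr
  · simp
  · apply forall_congr'
    intro i
    obtain ⟨i, hi⟩ := i
    cases i with
    | zero =>
      simp only [Fin.cons_succ]
      simp
    | succ i =>
      have : (⟨((⟨i + 1, hi⟩ : Fin r).succ : ℕ) - 1, by omega⟩ : Fin (r + 1))
        = Fin.succ ⟨i, by omega⟩ := by ext; simp
      rw [this, Fin.cons_succ, Fin.cons_succ, dif_neg (by simp), dif_neg (by simp)]
      rfl

lemma U_eq {R : Type*} [CommRing R] {N : ℕ} (W : Bool × Fin N → ℕ → R) (r : ℕ) :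
    ∀ (m : ℕ) (k : Fin r → ℕ), U W m (List.ofFn k) =
      ∑ c : Fin r → Bool × Fin N, if valid m c then ∏ i, W (c i) (k i) else 0 := by
  induction r with
  | zero =>
    intro m k
    simp [U, valid]
  | succ r ih =>
    intro m k
    rw [List.ofFn_succ, U, ← (Fin.consEquiv (fun _ : Fin (r + 1) => Bool × Fin N)).sum_comp,
      Fintype.sum_prod_type (γ := R) (α₁ := Bool × Fin N) (α₂ := Fin r → Bool × Fin N)]
    apply Finset.sum_congr rfl
    intro x _
    rw [ih]
    simp only [Fin.consEquiv, Equiv.coe_fn_mk, valid_cons, Fin.prod_univ_succ, Fin.cons_zero,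
      Fin.cons_succ]
    by_cases h : rel m x
    · simp only [h, if_true, true_and, Finset.mul_sum, mul_ite, mul_zero]
    · simp [h]

/-- The weight of a letter. -/
noncomputable def wt (N : ℕ) (c : Bool × Fin N) (a : ℕ) : RatFunc ℚ :=
  if (c.2 : ℕ) = 0 then 0 else
    if c.1 then -(1 / ((N : RatFunc ℚ) - ((c.2 : ℕ) : RatFunc ℚ) + RatFunc.X) ^ a)
    else 1 / (((c.2 : ℕ) : RatFunc ℚ)) ^ a

lemma FN_eq (N r : ℕ) (k : Fin r → ℕ) : FN N k = U (wt N) 0 (List.ofFn k) := by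
  rw [U_eq, FN, ← (Equiv.arrowProdEquivProdArrow (Fin r) (fun _ => Bool)
      (fun _ => Fin N)).symm.sum_comp, Fintype.sum_prod_type]
  let e : Finset (Fin r) ≃ (Fin r → Bool) :=
    { toFun := fun A i => decide (i ∈ A)
      invFun := fun f => Finset.univ.filter (fun i => f i = true)
      left_inv := by intro A; ext i; simp
      right_inv := by intro f; funext i; simp }
  rw [← e.sum_comp]
  apply Finset.sum_congr rfl
  intro A _
  rw [Finset.mul_sum, Finset.sum_filter]
  apply Finset.sum_congr rfl
  intro n _
  by_cases hpos : ∀ i, 0 < (n i : ℕ)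
  · have hv : valid 0 ((Equiv.arrowProdEquivProdArrow (Fin r) (fun _ => Bool)
        (fun _ => Fin N)).symm (e A, n)) ↔ ∀ (i : Fin r) (h : (i : ℕ) + 1 < r),
        if (⟨(i : ℕ) + 1, h⟩ : Fin r) ∈ A then n i < n ⟨(i : ℕ) + 1, h⟩
        else n i ≤ n ⟨(i : ℕ) + 1, h⟩ := by
      constructor
      · intro H i h
        have := H ⟨i + 1, h⟩
        simpa [rel, e] using this
      · intro H i
        obtain ⟨i, hi⟩ := i
        cases i with
        | zero => simp [rel, hpos]
        | succ i =>
          have := H ⟨i, by omega⟩ hi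
          simpa [rel, e] using this
    simp only [hv, hpos, implies_true, true_and]
    split_ifs
    · have : (-1 : RatFunc ℚ) ^ A.card = ∏ i : Fin r, if i ∈ A then (-1 : RatFunc ℚ) else 1 := by
        simp
      rw [this, ← Finset.prod_mul_distrib]
      apply Finset.prod_congr rfl
      intro i _
      have h0 : (n i : ℕ) ≠ 0 := (hpos i).ne'
      by_cases hA : i ∈ A <;> simp [wt, e, hA, h0]
    · rfl
  · rw [if_neg (by tauto)]
    push Not at hpos
    obtain ⟨i, hi⟩ := hpos
    symm
    split_ifs
    · apply Finset.prod_eq_zero (Finset.mem_univ i)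
      simp only [wt]
      rw [if_pos]
      simpa using hi
    · rfl

lemma FN_mult (N : ℕ) : Mult (U (wt N) 0) := by
  apply U_mult
  · intro n a b
    unfold wt
    split_ifs <;> simp_all [pow_add, mul_comm]
  · intro n a b
    unfold wt
    split_ifs <;> simp_all [pow_add, mul_comm]

/-- Splitting strictly monotone maps according to whether `0` is hit. -/
lemma sum_strictMono {R : Type*} [CommRing R] (r m : ℕ)
    (Ψ : (Fin (r + 1) → Fin (m + 1)) → R) :
    ∑ f : Fin (r + 1) → Fin (m + 1), (if StrictMono f then Ψ f else 0) =
      ∑ f : Fin r → Fin m, (if StrictMono f then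
        Ψ (Fin.cons 0 (fun i => (f i).succ)) else 0) +
      ∑ f : Fin (r + 1) → Fin m, (if StrictMono f then Ψ (fun i => (f i).succ) else 0) := by
  simp only [← Finset.sum_filter]
  have inj1 : Function.Injective (fun (f : Fin r → Fin m) =>
      (Fin.cons 0 (fun i => (f i).succ) : Fin (r + 1) → Fin (m + 1))) := by
    intro f g h
    funext i
    have := congrFun h i.succ
    simpa using this
  have inj2 : Function.Injective (fun (f : Fin (r + 1) → Fin m) =>
      (fun i => (f i).succ : Fin (r + 1) → Fin (m + 1))) := by
    intro f g h
    funext i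
    have := congrFun h i
    simpa using this
  rw [← Finset.sum_image (f := Ψ) (fun a _ b _ h => inj1 h),
    ← Finset.sum_image (f := Ψ) (fun a _ b _ h => inj2 h), ← Finset.sum_union]
  · apply Finset.sum_congr _ (fun _ _ => rfl)
    ext f
    simp only [Finset.mem_filter, Finset.mem_univ, true_and, Finset.mem_union, Finset.mem_image]
    constructor
    · intro hf
      by_cases h0 : f 0 = 0
      · left
        have hne : ∀ i : Fin r, f i.succ ≠ 0 := by
          intro i hi
          have := hf (Fin.succ_pos i)
          rw [hi] at this
          exact absurd this (Fin.not_lt_zero _)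
        refine ⟨fun i => (f i.succ).pred (hne i), ?_, ?_⟩
        · intro i j hij
          exact Fin.pred_lt_pred_iff.mpr (hf (Fin.succ_lt_succ_iff.mpr hij))
        · funext i
          refine Fin.cases ?_ (fun i => ?_) i
          · simp [h0]
          · simp
      · right
        have hne : ∀ i, f i ≠ 0 := by
          intro i hi
          have := hf.monotone (Fin.zero_le i)
          rw [hi] at this
          exact h0 (Fin.le_zero_iff.mp this)
        refine ⟨fun i => (f i).pred (hne i), ?_, ?_⟩
        · intro i j hij
          exact Fin.pred_lt_pred_iff.mpr (hf hij)
        · funext i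
          simp
    · rintro (⟨g, hg, rfl⟩ | ⟨g, hg, rfl⟩)
      · intro i j
        refine Fin.cases ?_ (fun i => ?_) i
        · refine Fin.cases ?_ (fun j => ?_) j
          · simp
          · simp
        · refine Fin.cases ?_ (fun j => ?_) j
          · simp
          · intro h
            simpa using hg (Fin.succ_lt_succ_iff.mp h)
      · intro i j h
        simpa using hg h
  · rw [Finset.disjoint_left]
    intro f h1 h2
    simp only [Finset.mem_filter, Finset.mem_univ, true_and, Finset.mem_image] at h1 h2
    obtain ⟨g, _, rfl⟩ := h1
    obtain ⟨g', _, h⟩ := h2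
    have := congrFun h 0
    simp at this

/-- Joint surjectivity. -/
def JS {r s m : ℕ} (f : Fin r → Fin m) (g : Fin s → Fin m) : Prop :=
  ∀ j, (∃ i, f i = j) ∨ (∃ i, g i = j)

/-- The merged index. -/
def mg {r s m : ℕ} (k : Fin r → ℕ) (l : Fin s → ℕ) (f : Fin r → Fin m) (g : Fin s → Fin m) :
    Fin m → ℕ :=
  fun j => (∑ i, if f i = j then k i else 0) + ∑ i, if g i = j then l i else 0

/-- Sum over quasi-shuffles with `m` letters. -/
noncomputable def T {R : Type*} [CommRing R] (r s m : ℕ) (k : Fin r → ℕ) (l : Fin s → ℕ)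
    (Φ : List ℕ → R) : R :=
  ∑ f : Fin r → Fin m, if StrictMono f then
    (∑ g : Fin s → Fin m, if StrictMono g then
      (if JS f g then Φ (List.ofFn (mg k l f g)) else 0) else 0) else 0

lemma T_succ {R : Type*} [CommRing R] (r s m : ℕ) (k : Fin (r + 1) → ℕ) (l : Fin (s + 1) → ℕ)
    (Φ : List ℕ → R) :
    T (r + 1) (s + 1) (m + 1) k l Φ =
      T r (s + 1) m (fun i => k i.succ) l (fun w => Φ (k 0 :: w)) +
      T (r + 1) s m k (fun i => l i.succ) (fun w => Φ (l 0 :: w)) +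
      T r s m (fun i => k i.succ) (fun i => l i.succ) (fun w => Φ ((k 0 + l 0) :: w)) := by
  have j1 : ∀ (f : Fin r → Fin m) (g : Fin (s + 1) → Fin m),
      JS (Fin.cons 0 (fun i => (f i).succ) : Fin (r + 1) → Fin (m + 1)) (fun i => (g i).succ)
        ↔ JS f g := by
    intro f g
    unfold JS
    rw [Fin.forall_fin_succ]
    simp [Fin.exists_fin_succ, Fin.succ_ne_zero, (Fin.succ_ne_zero _).symm]
  have j2 : ∀ (f : Fin (r + 1) → Fin m) (g : Fin s → Fin m),
      JS (fun i => (f i).succ) (Fin.cons 0 (fun i => (g i).succ) : Fin (s + 1) → Fin (m + 1))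
        ↔ JS f g := by
    intro f g
    unfold JS
    rw [Fin.forall_fin_succ]
    simp [Fin.exists_fin_succ, Fin.succ_ne_zero, (Fin.succ_ne_zero _).symm]
  have j3 : ∀ (f : Fin r → Fin m) (g : Fin s → Fin m),
      JS (Fin.cons 0 (fun i => (f i).succ) : Fin (r + 1) → Fin (m + 1))
        (Fin.cons 0 (fun i => (g i).succ) : Fin (s + 1) → Fin (m + 1))
        ↔ JS f g := by
    intro f g
    unfold JS
    rw [Fin.forall_fin_succ]
    simp [Fin.exists_fin_succ, Fin.succ_ne_zero, (Fin.succ_ne_zero _).symm]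
  have j4 : ∀ (f : Fin (r + 1) → Fin m) (g : Fin (s + 1) → Fin m),
      ¬ JS (fun i => (f i).succ) (fun i => (g i).succ) := by
    intro f g h
    rcases h 0 with ⟨i, hi⟩ | ⟨i, hi⟩ <;> exact Fin.succ_ne_zero _ hi
  have m1 : ∀ (f : Fin r → Fin m) (g : Fin (s + 1) → Fin m),
      List.ofFn (mg k l (Fin.cons 0 (fun i => (f i).succ) : Fin (r + 1) → Fin (m + 1))
        (fun i => (g i).succ)) = k 0 :: List.ofFn (mg (fun i => k i.succ) l f g) := by
    intro f g
    rw [List.ofFn_succ]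
    simp [mg, Fin.sum_univ_succ (n := r), Fin.succ_ne_zero, (Fin.succ_ne_zero _).symm]
    rfl
  have m2 : ∀ (f : Fin (r + 1) → Fin m) (g : Fin s → Fin m),
      List.ofFn (mg k l (fun i => (f i).succ)
        (Fin.cons 0 (fun i => (g i).succ) : Fin (s + 1) → Fin (m + 1)))
        = l 0 :: List.ofFn (mg k (fun i => l i.succ) f g) := by
    intro f g
    rw [List.ofFn_succ]
    simp [mg, Fin.sum_univ_succ (n := s), Fin.succ_ne_zero, (Fin.succ_ne_zero _).symm]
    rfl
  have m3 : ∀ (f : Fin r → Fin m) (g : Fin s → Fin m),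
      List.ofFn (mg k l (Fin.cons 0 (fun i => (f i).succ) : Fin (r + 1) → Fin (m + 1))
        (Fin.cons 0 (fun i => (g i).succ) : Fin (s + 1) → Fin (m + 1)))
        = (k 0 + l 0) :: List.ofFn (mg (fun i => k i.succ) (fun i => l i.succ) f g) := by
    intro f g
    rw [List.ofFn_succ]
    simp [mg, Fin.sum_univ_succ, Fin.succ_ne_zero, (Fin.succ_ne_zero _).symm]
    rfl
  unfold T
  rw [sum_strictMono]
  simp only [sum_strictMono s m, j1, j2, j3, j4, m1, m2, m3, if_false, ite_self,
    Finset.sum_const_zero, add_zero]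
  have split : ∀ (p : Prop) [Decidable p] (a b : R), (if p then a + b else 0) =
      (if p then a else 0) + (if p then b else 0) := by
    intro p _ a b
    split_ifs <;> simp
  simp only [split, Finset.sum_add_distrib]
  ring

lemma strictMono_bij_id {n : ℕ} (g : Fin n → Fin n) (h : StrictMono g) : g = id := by
  apply (StrictMono.range_inj h strictMono_id).mp
  rw [(Finite.injective_iff_surjective.mp h.injective).range_eq]
  simp

lemma T_zero_left {R : Type*} [CommRing R] (s m : ℕ) (k : Fin 0 → ℕ) (l : Fin s → ℕ)
    (Φ : List ℕ → R) : T 0 s m k l Φ = if m = s then Φ (List.ofFn l) else 0 := by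
  unfold T
  rw [Fintype.sum_unique, if_pos (show StrictMono (default : Fin 0 → Fin m) from fun i => i.elim0)]
  split_ifs with h
  · subst h
    rw [Finset.sum_eq_single id]
    · rw [if_pos strictMono_id, if_pos (show JS (default : Fin 0 → Fin m) id from fun j => Or.inr ⟨j, rfl⟩)]
      congr 2
      funext j
      simp [mg]
    · intro g _ hg
      rw [if_neg (fun h => hg (strictMono_bij_id g h))]
    · simp
  · apply Finset.sum_eq_zero
    intro g _
    by_cases hg : StrictMono g
    · rw [if_pos hg, if_neg]
      intro hJ
      have hs : Function.Surjective g := by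
        intro j
        rcases hJ j with ⟨i, _⟩ | h
        · exact i.elim0
        · exact h
      have := Fintype.card_of_bijective ⟨hg.injective, hs⟩
      simp at this
      omega
    · rw [if_neg hg]

lemma T_comm {R : Type*} [CommRing R] (r s m : ℕ) (k : Fin r → ℕ) (l : Fin s → ℕ)
    (Φ : List ℕ → R) : T r s m k l Φ = T s r m l k Φ := by
  have hJ : ∀ (f : Fin r → Fin m) (g : Fin s → Fin m), JS f g ↔ JS g f :=
    fun f g => forall_congr' fun j => or_comm
  have hm : ∀ (f : Fin r → Fin m) (g : Fin s → Fin m), mg k l f g = mg l k g f :=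
    fun f g => funext fun j => add_comm _ _
  unfold T
  have pull : ∀ {α : Type} [Fintype α] (p : Prop) [Decidable p] (F : α → R),
      (if p then ∑ a, F a else 0) = ∑ a, if p then F a else 0 := by
    intro α _ p _ F
    split_ifs <;> simp
  simp only [pull]
  rw [Finset.sum_comm]
  simp only [hJ, hm]
  refine Finset.sum_congr rfl fun g _ => Finset.sum_congr rfl fun f _ => ?_
  split_ifs <;> rfl

lemma T_eq_zero {R : Type*} [CommRing R] (r s m : ℕ) (k : Fin r → ℕ) (l : Fin s → ℕ)
    (Φ : List ℕ → R) (h : m < r) : T r s m k l Φ = 0 := by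
  unfold T
  apply Finset.sum_eq_zero
  intro f _
  rw [if_neg]
  intro hf
  have := Fintype.card_le_of_injective f hf.injective
  simp at this
  omega

lemma sum_T {R : Type*} [CommRing R] (M : ℕ) : ∀ (r s : ℕ), r + s < M →
    ∀ (k : Fin r → ℕ) (l : Fin s → ℕ) (Φ : List ℕ → R),
    ∑ m ∈ Finset.range M, (-1 : R) ^ (r + s + m) * T r s m k l Φ =
      Q (List.ofFn k) (List.ofFn l) Φ := by
  induction M with
  | zero => intro r s h; omega
  | succ M ih =>
    intro r s h k l Φ
    cases r with
    | zero =>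
      simp only [T_zero_left, List.ofFn_zero, Q_nil_left]
      rw [Finset.sum_eq_single s]
      · rw [if_pos rfl, Even.neg_one_pow ⟨s, by omega⟩, one_mul]
      · intro m _ hm
        rw [if_neg hm, mul_zero]
      · intro hs
        exact absurd (Finset.mem_range.mpr (by omega)) hs
    | succ r =>
      cases s with
      | zero =>
        simp only [T_comm (r + 1) 0, T_zero_left]
        rw [List.ofFn_zero (f := l), Q_nil_right, Finset.sum_eq_single (r + 1)]
        · rw [if_pos rfl, Even.neg_one_pow ⟨r + 1, by omega⟩, one_mul]
        · intro m _ hm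
          rw [if_neg hm, mul_zero]
        · intro hs
          exact absurd (Finset.mem_range.mpr (by omega)) hs
      | succ s =>
        rw [Finset.sum_range_succ', T_eq_zero _ _ 0 _ _ _ (Nat.succ_pos r), mul_zero, add_zero,
          List.ofFn_succ (f := k), List.ofFn_succ (f := l), Q_cons,
          ← List.ofFn_succ (f := k), ← List.ofFn_succ (f := l),
          ← ih r (s + 1) (by omega), ← ih (r + 1) s (by omega), ← ih r s (by omega),
          ← Finset.sum_add_distrib, ← Finset.sum_sub_distrib]
        apply Finset.sum_congr rfl
        intro m _
        rw [T_succ]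
        ring

lemma sum_sigma {R : Type*} [CommRing R] (r s m : ℕ) (k : Fin r → ℕ) (l : Fin s → ℕ)
    (Φ : List ℕ → R) :
    ∑ σ ∈ Finset.univ.filter (fun σ : Fin (r + s) → Fin m =>
            Function.Surjective σ ∧
            StrictMono (σ ∘ Fin.castAdd s) ∧ StrictMono (σ ∘ Fin.natAdd r)),
          Φ (List.ofFn (fun j => ∑ a ∈ Finset.univ.filter (fun a => σ a = j),
            Fin.append k l a)) = T r s m k l Φ := by
  rw [Finset.sum_filter, ← (Fin.appendEquiv r s).sum_comp, Fintype.sum_prod_type]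
  unfold T
  apply Finset.sum_congr rfl
  intro f _
  have pull : ∀ {α : Type} [Fintype α] (p : Prop) [Decidable p] (F : α → R),
      (if p then ∑ a, F a else 0) = ∑ a, if p then F a else 0 := by
    intro α _ p _ F
    split_ifs <;> simp
  rw [pull]
  apply Finset.sum_congr rfl
  intro g _
  have e1 : (Fin.appendEquiv r s (f, g)) ∘ Fin.castAdd s = f := by
    funext i; simp [Fin.appendEquiv]
  have e2 : (Fin.appendEquiv r s (f, g)) ∘ Fin.natAdd r = g := by
    funext i; simp [Fin.appendEquiv]
  have e3 : Function.Surjective (Fin.appendEquiv r s (f, g)) ↔ JS f g := by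
    refine forall_congr' fun j => ?_
    constructor
    · rintro ⟨a, ha⟩
      induction a using Fin.addCases with
      | left i => exact Or.inl ⟨i, by simpa [Fin.appendEquiv] using ha⟩
      | right i => exact Or.inr ⟨i, by simpa [Fin.appendEquiv] using ha⟩
    · rintro (⟨i, hi⟩ | ⟨i, hi⟩)
      · exact ⟨Fin.castAdd s i, by simpa [Fin.appendEquiv] using hi⟩
      · exact ⟨Fin.natAdd r i, by simpa [Fin.appendEquiv] using hi⟩
  have e4 : (fun j => ∑ a ∈ Finset.univ.filter (fun a => Fin.appendEquiv r s (f, g) a = j),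
            Fin.append k l a) = mg k l f g := by
    funext j
    rw [Finset.sum_filter, Fin.sum_univ_add]
    simp [Fin.appendEquiv, mg]
  simp only [e1, e2, e3, e4]
  split_ifs <;> first | rfl | tauto

end HP

/-- **Harmonic product formula for `F_N`.**  For indices `k` (depth `r`) and `l`
(depth `s`) and every positive integer `N`:
`F_N(k;t)·F_N(l;t) = ∑_{d=0}^{min(r,s)} (-1)^d ∑_{σ∈Σ_{r,s,d}} F_N(k^σ;t)`,
where `Σ_{r,s,d}` is the set of surjections `σ : Fin (r+s) → Fin (r+s-d)` strictly
increasing on the first `r` and on the last `s` positions and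
`k^σ_j = ∑_{σ a = j} (k ⊕ l) a`. -/
theorem FN_harmonic_product (N : ℕ) (hNpos : 0 < N) (r s : ℕ)
    (k : Fin r → ℕ) (l : Fin s → ℕ) (hk : ∀ i, 0 < k i) (hl : ∀ i, 0 < l i) :
    FN N k * FN N l =
      ∑ d ∈ Finset.range (min r s + 1),
        (-1 : RatFunc ℚ) ^ d *
        ∑ σ ∈ Finset.univ.filter (fun σ : Fin (r + s) → Fin (r + s - d) =>
            Function.Surjective σ ∧
            StrictMono (σ ∘ Fin.castAdd s) ∧ StrictMono (σ ∘ Fin.natAdd r)),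
          FN N (fun j => ∑ a ∈ Finset.univ.filter (fun a => σ a = j),
            Fin.append k l a) := by
  simp only [HP.FN_eq]
  rw [(HP.FN_mult N).2, ← HP.sum_T (r + s + 1) r s (by omega)]
  simp only [HP.sum_sigma]
  rw [← Finset.sum_range_reflect]
  symm
  have hsub : Finset.range (min r s + 1) ⊆ Finset.range (r + s + 1) :=
    Finset.range_subset_range.mpr (by omega)
  rw [Finset.sum_subset hsub]
  · apply Finset.sum_congr rfl
    intro d hd
    have hd' := Finset.mem_range.mp hd
    have e : r + s + 1 - 1 - d = r + s - d := by omega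
    rw [e]
    congr 1
    have e' : r + s + (r + s - d) = 2 * (r + s - d) + d := by omega
    rw [e', pow_add, pow_mul]
    simp
  · intro d hd hd2
    have hd' := Finset.mem_range.mp hd
    have hd2' : min r s + 1 ≤ d := by
      by_contra hh
      exact hd2 (Finset.mem_range.mpr (by omega))
    rcases le_total r s with hrs | hrs
    · rw [HP.T_comm, HP.T_eq_zero _ _ _ _ _ _ (by omega), mul_zero]
    · rw [HP.T_eq_zero _ _ _ _ _ _ (by omega), mul_zero]
end
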